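/- arXiv:2309.00991 — 5 statements merged into one kernel-verified Lean document; each statement's English description precedes it below -/
import Mathlib

section
/- The theory T∞ of the infinite-branching tree is pseudofinite: for every first-order sentence φ in the language of graphs such that φ holds in every model of T∞, there exists a finite simple graph whose associated graph-language structure satisfies φ. -/
open FirstOrder Language

namespace InfiniteBranchingTree

/-- The conjunction of a list of bounded formulas. -/
def listInf {L : Language} {α : Type} {n : ℕ} (l : List (L.BoundedFormula α n)) :
    L.BoundedFormula α n :=
  l.foldr (· ⊓ ·) ⊤

/-- Existentially quantify all bound variables except the first one. -/
def exsTail {L : Language} {α : Type} :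
    ∀ {n : ℕ}, L.BoundedFormula α (n + 1) → L.BoundedFormula α 1
  | 0, φ => φ
  | _ + 1, φ => exsTail φ.ex

/-- The sentence asserting that every vertex has at least `n` pairwise distinct
`R`-neighbors: `∀ x ∃ y₁ … yₙ (⋀_{i<j} yᵢ ≠ yⱼ ∧ ⋀_i x R yᵢ)`. -/
def minDegSentence (n : ℕ) : Language.graph.Sentence :=
  (exsTail (listInf
    ((((List.finRange n ×ˢ List.finRange n).filter fun ij => ij.1 < ij.2).map
        fun ij => ∼((&ij.1.succ) =' (&ij.2.succ))) ++
      ((List.finRange n).map fun i => adj.boundedFormula₂ (&0) (&i.succ))))).all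

/-- The sentence asserting that there is no cycle of length `n`: there are no pairwise
distinct `y₁, …, yₙ` with `y₁ R y₂, …, y_{n-1} R yₙ` and `yₙ R y₁`. -/
def noCycleSentence (n : ℕ) : Language.graph.Sentence :=
  ∼(BoundedFormula.exs (listInf
    ((((List.finRange n ×ˢ List.finRange n).filter fun ij => ij.1 < ij.2).map
        fun ij => ∼((&ij.1) =' (&ij.2))) ++
      ((List.finRange n).map fun i => adj.boundedFormula₂ (&i) (&(finRotate n i))))))

/-- The theory `T∞` of the infinite-branching tree: the theory of simple graphs
(irreflexivity and symmetry of `R`), together with, for each `n ≥ 1`, the sentence that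
every vertex has at least `n` distinct neighbors, and, for each `n ≥ 3`, the sentence
that there is no cycle of length `n`. -/
def Tinf : Language.graph.Theory :=
  Theory.simpleGraph ∪ {σ | ∃ n, 1 ≤ n ∧ σ = minDegSentence n} ∪
    {σ | ∃ n, 3 ≤ n ∧ σ = noCycleSentence n}

section Semantics

variable {L : Language} {M : Type*} [L.Structure M] {α : Type}

theorem realize_listInf {n : ℕ} (l : List (L.BoundedFormula α n)) (v : α → M) (xs : Fin n → M) :
    (listInf l).Realize v xs ↔ ∀ ψ ∈ l, ψ.Realize v xs :=
  BoundedFormula.realize_foldr_inf l v xs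

theorem realize_exsTail {n : ℕ} (ψ : L.BoundedFormula α (n + 1)) (v : α → M)
    (xs : Fin (n + 1) → M) (h : ψ.Realize v xs) :
    (exsTail ψ).Realize v fun _ => xs 0 := by
  induction n with
  | zero =>
    have hxs : (fun _ => xs 0) = xs := funext fun i => congrArg xs (Fin.fin_one_eq_zero i).symm
    rw [hxs]
    exact h
  | succ n ih =>
    refine ih ψ.ex (fun i => xs i.castSucc) ?_
    refine BoundedFormula.realize_ex.2 ⟨xs (Fin.last _), ?_⟩
    convert h using 1
    exact Fin.snoc_init_self xs

end Semantics

section Graph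

variable {V : Type*} (G : SimpleGraph V)

theorem realize_minDegSentence {n : ℕ}
    (h : ∀ x, ∃ y : Fin n → V, Function.Injective y ∧ ∀ i, G.Adj x (y i)) :
    @Sentence.Realize Language.graph V G.structure (minDegSentence n) := by
  let := G.structure
  refine BoundedFormula.realize_all.2 fun x => ?_
  obtain ⟨y, hy, hxy⟩ := h x
  have hx : Fin.snoc default x = fun _ : Fin (0 + 1) => (Fin.cons x y : Fin (n + 1) → V) 0 :=
    funext fun i => by rw [Fin.fin_one_eq_zero i]; rfl
  rw [hx]
  refine realize_exsTail _ _ _ ?_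
  rw [realize_listInf]
  simp only [List.mem_append, List.mem_map, List.mem_filter]
  rintro _ (⟨⟨i, j⟩, ⟨-, hij⟩, rfl⟩ | ⟨i, -, rfl⟩)
  · have hij : i < j := by simpa using hij
    simpa using hy.ne hij.ne
  · rw [BoundedFormula.realize_rel₂]
    exact hxy i

theorem realize_noCycleSentence {n : ℕ}
    (h : ∀ y : Fin n → V, Function.Injective y → ¬ ∀ i, G.Adj (y i) (y (finRotate n i))) :
    @Sentence.Realize Language.graph V G.structure (noCycleSentence n) := by
  let := G.structure
  refine BoundedFormula.realize_not.2 fun hcycle => ?_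
  obtain ⟨y, hy⟩ := BoundedFormula.realize_exs.1 hcycle
  rw [realize_listInf] at hy
  simp only [List.mem_append, List.mem_map, List.mem_filter] at hy
  refine h y (Function.Injective.of_lt_imp_ne fun i j hij heq => ?_) fun i => ?_
  · have := hy _ (.inl ⟨(i, j), ⟨by simp, by simpa using hij⟩, rfl⟩)
    simp [heq] at this
  · have := hy _ (.inr ⟨i, by simp, rfl⟩)
    rw [BoundedFormula.realize_rel₂] at this
    exact this

end Graph

/-- Words of length at most `N` over `Fin k` without two equal consecutive letters, i.e. the
ball of radius `N` in the `k`-regular tree with properly coloured edges. -/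
abbrev ReducedWord (k N : ℕ) : Type :=
  {l : List (Fin k) // l.length ≤ N ∧ l.IsChain (· ≠ ·)}

namespace ReducedWord

variable {k N : ℕ}

instance : Finite (ReducedWord k N) :=
  ((List.finite_length_le (Fin k) N).subset fun _ hl => hl.1).to_subtype

/-- The empty word. -/
def nil : ReducedWord k N := ⟨[], by simp⟩

/-- Move along the edge of colour `c`, staying put if this leaves the ball. -/
def move (c : Fin k) (w : ReducedWord k N) : ReducedWord k N :=
  if hc : w.1.head? = some c then
    ⟨w.1.tail, by have := w.2.1; rw [List.length_tail]; omega, w.2.2.tail⟩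
  else if hN : w.1.length < N then
    ⟨c :: w.1, by simpa using hN, List.isChain_cons.2
      ⟨fun d hd hcd => hc (by rw [hcd]; exact hd), w.2.2⟩⟩
  else w

theorem move_val_of_isChain (c : Fin k) (w : ReducedWord k N)
    (hc : (c :: w.1).IsChain (· ≠ ·)) (hN : w.1.length < N) : (move c w).1 = c :: w.1 := by
  have : w.1.head? ≠ some c := fun h => (List.isChain_cons.1 hc).1 c h rfl
  rw [move, dif_neg this, dif_pos hN]

theorem move_involutive (c : Fin k) : Function.Involutive (move (N := N) c) := by
  rintro ⟨l, hl, hl'⟩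
  by_cases hc : l.head? = some c
  · obtain ⟨t, rfl⟩ : ∃ t, l = c :: t := by
      cases l with
      | nil => simp at hc
      | cons d t => exact ⟨t, by simpa using hc⟩
    have hm : move c (⟨c :: t, hl, hl'⟩ : ReducedWord k N) =
        ⟨t, by simp at hl; omega, hl'.tail⟩ := by
      simp [move]
    rw [hm]
    exact Subtype.ext (move_val_of_isChain c _ hl' hl)
  · by_cases hN : l.length < N
    · simp [move, hc, hN]
    · simp [move, hc, hN]

/-- The permutation of the ball that moves every word along the edge of colour `c`. -/
def perm (c : Fin k) : Equiv.Perm (ReducedWord k N) := (move_involutive c).toPerm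

theorem perm_mul_self (c : Fin k) : perm c * perm c = (1 : Equiv.Perm (ReducedWord k N)) :=
  Equiv.ext fun w => move_involutive c w

theorem perm_apply_val (c : Fin k) (w : ReducedWord k N)
    (hc : (c :: w.1).IsChain (· ≠ ·)) (hN : w.1.length < N) : (perm c w).1 = c :: w.1 :=
  move_val_of_isChain c w hc hN

theorem perm_nil (hN : 0 < N) (c : Fin k) : (perm c (nil : ReducedWord k N)).1 = [c] :=
  perm_apply_val c nil (List.isChain_singleton c) hN

theorem perm_injective (hN : 0 < N) :
    Function.Injective (perm : Fin k → Equiv.Perm (ReducedWord k N)) := by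
  intro c d h
  have h := congrArg (fun g => (g nil).1) h
  simpa [perm_nil hN] using h

theorem perm_ne_one (hN : 0 < N) (c : Fin k) : (perm c : Equiv.Perm (ReducedWord k N)) ≠ 1 := by
  intro h
  have h := congrArg (fun g => (g nil).1) h
  rw [perm_nil hN] at h
  simp [nil] at h

end ReducedWord

open ReducedWord

/-- Biggs' graph: the Cayley graph of the permutations of a ball in the coloured `k`-regular
tree with respect to the involutions given by the colours. -/
def biggsGraph (k N : ℕ) : SimpleGraph (Equiv.Perm (ReducedWord k N)) where
  Adj g h := g ≠ h ∧ ∃ c, h = perm c * g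
  symm := ⟨by
    rintro g _ ⟨hne, c, rfl⟩
    exact ⟨hne.symm, c, by rw [← mul_assoc, perm_mul_self, one_mul]⟩⟩
  loopless := ⟨fun _ h => h.1 rfl⟩

theorem biggsGraph_exists_neighbors {k N n : ℕ} (hN : 0 < N) (hn : n ≤ k)
    (x : Equiv.Perm (ReducedWord k N)) :
    ∃ y : Fin n → Equiv.Perm (ReducedWord k N),
      Function.Injective y ∧ ∀ i, (biggsGraph k N).Adj x (y i) := by
  refine ⟨fun i => perm (i.castLE hn) * x, fun i j hij => ?_, fun i => ⟨fun h => ?_, _, rfl⟩⟩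
  · exact Fin.castLE_injective hn (perm_injective hN (mul_right_cancel hij))
  · exact perm_ne_one hN _ (right_eq_mul.1 h)

/-- A non-backtracking walk in Biggs' graph of positive length at most the radius of the ball is
not closed. -/
theorem biggsGraph_ne_of_nonbacktracking {k N n : ℕ} (hn : 0 < n) (hnN : n ≤ N)
    (z : ℕ → Equiv.Perm (ReducedWord k N)) (hz : ∀ j, (biggsGraph k N).Adj (z j) (z (j + 1)))
    (hne : ∀ j, z (j + 2) ≠ z j) : z n ≠ z 0 := by
  choose _ c hc using hz
  have hcc (j : ℕ) : c (j + 1) ≠ c j := fun h =>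
    hne j (by rw [hc (j + 1), h, hc j, ← mul_assoc, perm_mul_self, one_mul])
  have key : ∀ j < N, ∃ l, l.length = j ∧ (c j :: l).IsChain (· ≠ ·) ∧
      (z (j + 1) ((z 0)⁻¹ nil)).1 = c j :: l := by
    intro j
    induction j with
    | zero => exact fun hN => ⟨[], rfl, by simp, by simp [hc 0, perm_nil hN]⟩
    | succ j ih =>
      intro hj
      obtain ⟨l, hl, hchain, hval⟩ := ih (by omega)
      have hchain' : (c (j + 1) :: c j :: l).IsChain (· ≠ ·) :=
        List.isChain_cons_cons.2 ⟨hcc j, hchain⟩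
      refine ⟨c j :: l, by simp [hl], hchain', ?_⟩
      rw [hc (j + 1), Equiv.Perm.mul_apply,
        perm_apply_val _ _ (by rwa [hval]) (by rw [hval]; simp; omega), hval]
  intro h
  obtain ⟨l, -, -, hval⟩ := key (n - 1) (by omega)
  rw [Nat.sub_add_cancel hn, h, ← Equiv.Perm.mul_apply, mul_inv_cancel] at hval
  simp [nil] at hval

theorem biggsGraph_no_cycle {k N n : ℕ} (hn : 3 ≤ n) (hnN : n ≤ N)
    (y : Fin n → Equiv.Perm (ReducedWord k N)) (hy : Function.Injective y) :
    ¬ ∀ i, (biggsGraph k N).Adj (y i) (y (finRotate n i)) := by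
  intro h
  have : NeZero n := ⟨by omega⟩
  refine biggsGraph_ne_of_nonbacktracking (by omega) hnN (fun j => y (Fin.ofNat n j)) (fun j => ?_)
    (fun j hj => ?_) ?_
  · convert h (Fin.ofNat n j) using 2
    rw [finRotate_apply]
    ext
    simp [Fin.val_add]
  · have := congrArg Fin.val (hy hj)
    simp only [Fin.ofNat] at this
    have h2 : j + 2 ≡ j + 0 [MOD n] := this
    have := Nat.le_of_dvd (by norm_num) ((Nat.modEq_zero_iff_dvd).1 (Nat.ModEq.add_left_cancel' j h2))
    omega
  · exact congrArg y (Fin.ext (by simp [Fin.ofNat]))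

theorem eventually_realize_biggsGraph {σ : Language.graph.Sentence} (hσ : σ ∈ Tinf) :
    ∀ᶠ N in Filter.atTop,
      @Sentence.Realize Language.graph _ (biggsGraph N N).structure σ := by
  rcases hσ with (hσ | ⟨n, -, rfl⟩) | ⟨n, hn, rfl⟩
  · exact .of_forall fun N =>
      (@Theory.model_iff _ _ (biggsGraph N N).structure _).1 (simpleGraph_model _) σ hσ
  · filter_upwards [Filter.eventually_ge_atTop (n + 1)] with N hN
    exact realize_minDegSentence _ (biggsGraph_exists_neighbors (by omega) (by omega))
  · filter_upwards [Filter.eventually_ge_atTop n] with N hN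
    exact realize_noCycleSentence _ (biggsGraph_no_cycle hn hN)

/-- The theory `T∞` of the infinite-branching tree is pseudofinite:
every sentence of the language of graphs that holds in every model of `T∞` has a finite
(nonempty) simple graph as a model. -/
theorem Tinf_pseudofinite (φ : Language.graph.Sentence) (h : Tinf ⊨ᵇ φ) :
    ∃ (V : Type) (G : SimpleGraph V), Finite V ∧ Nonempty V ∧
      @Sentence.Realize Language.graph V G.structure φ := by
  obtain ⟨T₀, hT₀, hφ⟩ := Theory.models_iff_finset_models.1 h
  obtain ⟨N, hN⟩ := ((Filter.eventually_all_finset T₀).2 fun σ hσ =>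
    eventually_realize_biggsGraph (hT₀ hσ)).exists
  refine ⟨_, biggsGraph N N, inferInstance, inferInstance, ?_⟩
  let := (biggsGraph N N).structure
  have : Equiv.Perm (ReducedWord N N) ⊨ (T₀ : Language.graph.Theory) :=
    (Theory.model_iff _).2 hN
  exact hφ.realize_sentence _

end InfiniteBranchingTree
end

section
/- For every integer r ≥ 2, the theory T_r of the r-regular infinite tree is pseudofinite: for every first-order sentence φ in the language of graphs such that φ holds in every model of T_r, there exists a finite simple graph whose associated graph-language structure satisfies φ. -/
open FirstOrder Language

namespace RegularTree

/-- The conjunction of a list of bounded formulas. -/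
def listInf {L : Language} {α : Type} {n : ℕ} (l : List (L.BoundedFormula α n)) :
    L.BoundedFormula α n :=
  l.foldr (· ⊓ ·) ⊤

/-- The disjunction of a list of bounded formulas. -/
def listSup {L : Language} {α : Type} {n : ℕ} (l : List (L.BoundedFormula α n)) :
    L.BoundedFormula α n :=
  l.foldr (· ⊔ ·) ⊥

/-- Existentially quantify all bound variables except the first one. -/
def exsTail {L : Language} {α : Type} :
    ∀ {n : ℕ}, L.BoundedFormula α (n + 1) → L.BoundedFormula α 1
  | 0, φ => φ
  | _ + 1, φ => exsTail φ.ex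

/-- The sentence asserting that every vertex has exactly `r` pairwise distinct
`R`-neighbors: `∀x ∃y₁…y_r ((⋀_{i<j} yᵢ ≠ yⱼ) ∧ (⋀_i x R yᵢ) ∧ ∀z (x R z → ⋁_i z = yᵢ))`. -/
def exactDegSentence (r : ℕ) : Language.graph.Sentence :=
  (exsTail (listInf
    ((((List.finRange r ×ˢ List.finRange r).filter fun ij => ij.1 < ij.2).map
        fun ij => ∼((&ij.1.succ) =' (&ij.2.succ))) ++
      ((List.finRange r).map fun i => adj.boundedFormula₂ (&0) (&i.succ)) ++
      [∀'(adj.boundedFormula₂ (&0) (&(Fin.last (r + 1))) ⟹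
          listSup ((List.finRange r).map fun i =>
            (&(Fin.last (r + 1))) =' (&i.succ.castSucc)))]))).all

/-- The sentence asserting that there is no cycle of length `n`: there are no pairwise
distinct `y₁, …, yₙ` with `y₁ R y₂, …, y_{n-1} R yₙ` and `yₙ R y₁`. -/
def noCycleSentence (n : ℕ) : Language.graph.Sentence :=
  ∼(BoundedFormula.exs (listInf
    ((((List.finRange n ×ˢ List.finRange n).filter fun ij => ij.1 < ij.2).map
        fun ij => ∼((&ij.1) =' (&ij.2))) ++
      ((List.finRange n).map fun i => adj.boundedFormula₂ (&i) (&(finRotate n i))))))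

/-- The theory `T_r` of the `r`-regular infinite tree: the theory of simple graphs
(irreflexivity and symmetry of `R`), together with the sentence that every vertex has
exactly `r` distinct neighbors, and, for each `n ≥ 3`, the sentence that there is no
cycle of length `n`. -/
def Tr (r : ℕ) : Language.graph.Theory :=
  Theory.simpleGraph ∪ {exactDegSentence r} ∪ {σ | ∃ n, 3 ≤ n ∧ σ = noCycleSentence n}

/-- The words over `Fin r` of length at most `N` without equal consecutive letters: the ball of
radius `N` in the `r`-regular tree. -/
def ReducedWord (r N : ℕ) : Type :=
  {l : List (Fin r) // l.IsChain (· ≠ ·) ∧ l.length ≤ N}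

namespace ReducedWord

variable {r N : ℕ}

instance : Finite (ReducedWord r N) :=
  ((List.finite_length_le (Fin r) N).subset fun _ h => h.2).to_subtype

/-- The empty word. -/
def nil : ReducedWord r N := ⟨[], by simp⟩

/-- Move along the edge labelled `i`, staying in place if this would leave the ball. -/
def step (i : Fin r) (w : ReducedWord r N) : ReducedWord r N :=
  if h : w.1.head? = some i then
    ⟨w.1.tail, w.2.1.tail, by simpa using Nat.le_succ_of_le w.2.2⟩
  else if h' : w.1.length < N then
    ⟨i :: w.1, List.isChain_cons.2 ⟨fun y hy e => h (e ▸ hy), w.2.1⟩, h'⟩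
  else w

theorem step_val_of_lt {i : Fin r} {w : ReducedWord r N} (h : w.1.head? ≠ some i)
    (h' : w.1.length < N) : (step i w).1 = i :: w.1 := by
  simp [step, h, h']

theorem step_involutive (i : Fin r) : Function.Involutive (step (N := N) i) := by
  rintro ⟨l, hl, hN⟩
  by_cases h : l.head? = some i
  · obtain ⟨t, rfl⟩ : ∃ t, l = i :: t := by
      cases l with
      | nil => simp at h
      | cons a t => exact ⟨t, by simpa using h⟩
    have ht : t.head? ≠ some i := fun e => (List.isChain_cons.1 hl).1 i e rfl
    have hlt : t.length < N := by simpa using hN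
    simp [step, ht, hlt]
    rfl
  · by_cases h' : l.length < N <;> simp [step, h, h'] <;> rfl

/-- The permutation of reduced words given by the edge label `i`. -/
def stepPerm (i : Fin r) : Equiv.Perm (ReducedWord r N) := (step_involutive i).toPerm

@[simp]
theorem stepPerm_apply (i : Fin r) (w : ReducedWord r N) : stepPerm i w = step i w := rfl

@[simp]
theorem stepPerm_mul_stepPerm_mul (i : Fin r) (g : Equiv.Perm (ReducedWord r N)) :
    stepPerm i * (stepPerm i * g) = g := by
  ext w : 1
  simp [step_involutive i _]

theorem step_nil_val (hN : 0 < N) (i : Fin r) : (step i (nil : ReducedWord r N)).1 = [i] :=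
  step_val_of_lt (by simp [nil]) (by simpa [nil] using hN)

theorem stepPerm_injective (hN : 0 < N) :
    Function.Injective (stepPerm : Fin r → Equiv.Perm (ReducedWord r N)) := by
  intro i j h
  have h' := congrArg Subtype.val (Equiv.congr_fun h nil)
  simpa [step_nil_val hN] using h'

theorem stepPerm_ne_one (hN : 0 < N) (i : Fin r) :
    (stepPerm i : Equiv.Perm (ReducedWord r N)) ≠ 1 := by
  intro h
  have h' := congrArg Subtype.val (Equiv.congr_fun h nil)
  simp [step_nil_val hN] at h'
  simp [nil] at h'

end ReducedWord

open ReducedWord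

/-- The Cayley graph of the permutation group of `ReducedWord r N` with respect to the
involutions `stepPerm i`. It is `r`-regular and has no cycles of length at most `N`. -/
def stepGraph (r N : ℕ) (hN : 0 < N) : SimpleGraph (Equiv.Perm (ReducedWord r N)) where
  Adj g h := ∃ i, h = stepPerm i * g
  symm := ⟨by
    rintro g h ⟨i, rfl⟩
    exact ⟨i, by simp⟩⟩
  loopless := ⟨by
    rintro g ⟨i, hi⟩
    exact stepPerm_ne_one hN i (by simpa using hi.symm)⟩

theorem length_of_stepPerm_path {r N : ℕ} (z : ℕ → Equiv.Perm (ReducedWord r N)) (c : ℕ → Fin r)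
    (hz : ∀ k, z (k + 1) = stepPerm (c k) * z k) (hc : ∀ k, c k ≠ c (k + 1)) :
    ∀ k ≤ N, (z k ((z 0).symm nil)).1.length = k ∧ (z k ((z 0).symm nil)).1.head? ≠ some (c k)
  | 0, _ => by simp only [Equiv.apply_symm_apply]; simp [nil]
  | k + 1, hk => by
    obtain ⟨hl, hh⟩ := length_of_stepPerm_path z c hz hc k (by omega)
    have := step_val_of_lt hh (by omega)
    rw [hz k, Equiv.Perm.mul_apply, stepPerm_apply, this]
    simp [hl, hc k]

theorem stepGraph_no_cycle {r N n : ℕ} (hN : 0 < N) (hn : 3 ≤ n) (hnN : n ≤ N)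
    (y : Fin n → Equiv.Perm (ReducedWord r N)) (hy : Function.Injective y)
    (hadj : ∀ i, (stepGraph r N hN).Adj (y i) (y (finRotate n i))) : False := by
  obtain ⟨m, rfl⟩ : ∃ m, n = m + 3 := ⟨n - 3, by omega⟩
  choose c hc using hadj
  have hcne (i) : c i ≠ c (i + 1) := by
    intro h
    have h2 := hc (i + 1)
    rw [← h] at h2
    have h1 := hc i
    simp only [finRotate_apply] at h1 h2
    rw [h1, stepPerm_mul_stepPerm_mul] at h2
    have h3 := hy h2
    rw [add_assoc, add_eq_left] at h3
    have h4 : 2 % (m + 3) = 0 := by simpa [Fin.val_add] using congrArg Fin.val h3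
    rw [Nat.mod_eq_of_lt (by omega)] at h4
    omega
  have hsucc (k : ℕ) : Fin.ofNat (m + 3) (k + 1) = Fin.ofNat (m + 3) k + 1 := by
    simp [Fin.ext_iff, Fin.val_add]
  have hlast : Fin.ofNat (m + 3) (m + 3) = Fin.ofNat (m + 3) 0 := by simp
  have key := (length_of_stepPerm_path (fun k => y (Fin.ofNat (m + 3) k))
    (fun k => c (Fin.ofNat (m + 3) k))
    (fun k => by rw [hsucc, ← finRotate_apply]; exact hc _)
    (fun k => by rw [hsucc]; exact hcne _) (m + 3) hnN).1
  rw [hlast, Equiv.apply_symm_apply] at key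
  simp [nil] at key

theorem realize_exsTail {L : Language} {α M : Type} [L.Structure M] {v : α → M} :
    ∀ {n : ℕ} (φ : L.BoundedFormula α (n + 1)) (y : Fin (n + 1) → M), φ.Realize v y →
      (exsTail φ).Realize v fun _ => y 0
  | 0, φ, y, h => by
    have hy : (fun _ => y 0) = y := funext fun i => congrArg y (Fin.ext (by omega))
    rwa [hy]
  | n + 1, φ, y, h => by
    have := realize_exsTail φ.ex (Fin.init y)
      (BoundedFormula.realize_ex.2 ⟨y (Fin.last _), by simpa using h⟩)
    exact this

theorem realize_exactDegSentence {V : Type} (G : SimpleGraph V) {r : ℕ}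
    (nbr : V → Fin r → V) (hinj : ∀ x, Function.Injective (nbr x))
    (hadj : ∀ x y, G.Adj x y ↔ ∃ i, y = nbr x i) :
    @Sentence.Realize _ V G.structure (exactDegSentence r) := by
  let := G.structure
  have hrel (x y : V) : Structure.RelMap adj ![x, y] ↔ G.Adj x y := Iff.rfl
  intro x
  have hx : (Fin.snoc default x : Fin 1 → V) =
      fun _ => (Fin.cons x (nbr x) : Fin (r + 1) → V) 0 := by
    funext i
    rw [Fin.fin_one_eq_zero i]
    rfl
  rw [hx]
  apply realize_exsTail
  rw [listInf, BoundedFormula.realize_foldr_inf]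
  simp only [List.mem_append, List.mem_map, List.mem_filter, List.mem_singleton]
  rintro ψ ((⟨⟨i, j⟩, ⟨-, hij⟩, rfl⟩ | ⟨i, -, rfl⟩) | rfl)
  · simpa using fun e => (of_decide_eq_true hij).ne (hinj x e)
  · simp [hrel, hadj]
  · simp only [BoundedFormula.realize_all, BoundedFormula.realize_imp,
      BoundedFormula.realize_rel₂, hrel, hadj, listSup, BoundedFormula.realize_foldr_sup]
    rintro z ⟨i, hi⟩
    refine ⟨_, List.mem_map_of_mem (List.mem_finRange i), ?_⟩
    simp only [Function.comp_apply, BoundedFormula.realize_bdEqual, Term.realize_var,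
      Sum.elim_inr, Fin.snoc_last, Fin.snoc_castSucc] at hi ⊢
    rw [Fin.cons_succ, hi]
    congr 1

theorem realize_noCycleSentence {V : Type} (G : SimpleGraph V) {n : ℕ}
    (h : ∀ y : Fin n → V, Function.Injective y → ¬ ∀ i, G.Adj (y i) (y (finRotate n i))) :
    @Sentence.Realize _ V G.structure (noCycleSentence n) := by
  let := G.structure
  have hrel (x y : V) : Structure.RelMap adj ![x, y] ↔ G.Adj x y := Iff.rfl
  rw [noCycleSentence, Sentence.Realize, Formula.realize_not, BoundedFormula.realize_exs]
  rintro ⟨y, hy⟩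
  rw [listInf, BoundedFormula.realize_foldr_inf] at hy
  simp only [List.mem_append, List.mem_map, List.mem_filter] at hy
  refine h y ?_ fun i => ?_
  · have hlt {i j : Fin n} (hij : i < j) : y i ≠ y j := by
      simpa using hy _ (.inl ⟨(i, j), ⟨by simp, by simpa using hij⟩, rfl⟩)
    intro i j hij
    by_contra hne
    rcases lt_or_gt_of_ne hne with h | h
    exacts [hlt h hij, hlt h hij.symm]
  · simpa [hrel] using hy _ (.inr ⟨i, List.mem_finRange i, rfl⟩)

theorem exists_bound_of_subset_Tr {r : ℕ} (T : Finset Language.graph.Sentence)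
    (hT : (T : Language.graph.Theory) ⊆ Tr r) :
    ∃ N, 0 < N ∧ ∀ σ ∈ T, σ ∈ Theory.simpleGraph ∨ σ = exactDegSentence r ∨
      ∃ n, 3 ≤ n ∧ n ≤ N ∧ σ = noCycleSentence n := by
  refine ((Filter.eventually_gt_atTop 0).and ((Filter.eventually_all_finset T).2 ?_)).exists
  intro σ hσ
  rcases hT hσ with (h | h) | ⟨n, hn, h⟩
  · exact .of_forall fun _ => .inl h
  · exact .of_forall fun _ => .inr (.inl h)
  · filter_upwards [Filter.eventually_ge_atTop n] with N hN
    exact .inr (.inr ⟨n, hn, hN, h⟩)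

/-- For every integer `r ≥ 2`, the theory `T_r` of the `r`-regular
infinite tree is pseudofinite: every sentence of the language of graphs that holds in
every model of `T_r` has a finite (nonempty) simple graph as a model. -/
theorem Tr_pseudofinite (r : ℕ) (hr : 2 ≤ r) (φ : Language.graph.Sentence)
    (h : Tr r ⊨ᵇ φ) :
    ∃ (V : Type) (G : SimpleGraph V), Finite V ∧ Nonempty V ∧
      @Sentence.Realize Language.graph V G.structure φ := by
  obtain ⟨T, hT, hTφ⟩ := Theory.models_iff_finset_models.1 h
  obtain ⟨N, hN, hTN⟩ := exists_bound_of_subset_Tr T hT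
  refine ⟨_, stepGraph r N hN, inferInstance, inferInstance, ?_⟩
  let := (stepGraph r N hN).structure
  have : Equiv.Perm (ReducedWord r N) ⊨ (T : Language.graph.Theory) := by
    refine ⟨fun σ hσ => ?_⟩
    rcases hTN σ hσ with h | rfl | ⟨n, hn, hnN, rfl⟩
    · exact (simpleGraph_model (stepGraph r N hN)).realize_of_mem σ h
    · exact realize_exactDegSentence _ (fun g i => stepPerm i * g)
        (fun g i j hij => stepPerm_injective hN (mul_right_cancel hij)) fun _ _ => Iff.rfl
    · exact realize_noCycleSentence _ (stepGraph_no_cycle hN hn hnN)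
  exact hTφ.realize_sentence (Equiv.Perm (ReducedWord r N))

end RegularTree
end

section
/- The theory T∞ is complete: it is satisfiable, and for every sentence φ of the first-order language of graphs, either φ holds in every model of T∞ or ¬φ holds in every model of T∞. -/
open FirstOrder Language

namespace InfiniteBranchingTree

/-! ### Partial isomorphisms between forests -/

section PartialIso

variable {V W : Type*} {G : SimpleGraph V} {H : SimpleGraph W} {S : Set (V × W)}

/-- The graph on `V × W` whose edges are the pairs in `S` that are adjacent in both coordinates. -/
def commonGraph (G : SimpleGraph V) (H : SimpleGraph W) (S : Set (V × W)) :
    SimpleGraph (V × W) where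
  Adj p q := p ∈ S ∧ q ∈ S ∧ G.Adj p.1 q.1 ∧ H.Adj p.2 q.2
  symm := ⟨fun _ _ h => ⟨h.2.1, h.1, h.2.2.1.symm, h.2.2.2.symm⟩⟩
  loopless := ⟨fun p h => G.loopless.irrefl p.1 h.2.2.1⟩

/-- `S` is the graph of an isomorphism between finite subgraphs of `G` and `H`, such that
vertices of either subgraph that are connected in the ambient graph are already connected in the
subgraph. -/
structure IsPartialIso (G : SimpleGraph V) (H : SimpleGraph W) (S : Set (V × W)) : Prop where
  finite : S.Finite
  eq_iff : ∀ p ∈ S, ∀ q ∈ S, p.1 = q.1 ↔ p.2 = q.2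
  adj_iff : ∀ p ∈ S, ∀ q ∈ S, G.Adj p.1 q.1 ↔ H.Adj p.2 q.2
  reachable_fst : ∀ p ∈ S, ∀ q ∈ S, G.Reachable p.1 q.1 → (commonGraph G H S).Reachable p q
  reachable_snd : ∀ p ∈ S, ∀ q ∈ S, H.Reachable p.2 q.2 → (commonGraph G H S).Reachable p q

theorem isPartialIso_empty : IsPartialIso G H ∅ := by
  constructor <;> simp

theorem commonGraph_mono {S' : Set (V × W)} (h : S ⊆ S') :
    commonGraph G H S ≤ commonGraph G H S' :=
  fun _ _ hpq => ⟨h hpq.1, h hpq.2.1, hpq.2.2⟩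

theorem reachable_swap_commonGraph {p q : V × W} (h : (commonGraph G H S).Reachable p q) :
    (commonGraph H G (Prod.swap ⁻¹' S)).Reachable p.swap q.swap :=
  h.map (G := commonGraph G H S) (G' := commonGraph H G (Prod.swap ⁻¹' S))
    ⟨Prod.swap, fun {_ _} h => ⟨h.1, h.2.1, h.2.2.2, h.2.2.1⟩⟩

theorem IsPartialIso.swap (h : IsPartialIso G H S) : IsPartialIso H G (Prod.swap ⁻¹' S) where
  finite := h.finite.preimage Prod.swap_injective.injOn
  eq_iff _ hp _ hq := (h.eq_iff _ hp _ hq).symm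
  adj_iff _ hp _ hq := (h.adj_iff _ hp _ hq).symm
  reachable_fst _ hp _ hq hr := reachable_swap_commonGraph (h.reachable_snd _ hp _ hq hr)
  reachable_snd _ hp _ hq hr := reachable_swap_commonGraph (h.reachable_fst _ hp _ hq hr)

theorem IsPartialIso.fst_eq_of_adj (h : IsPartialIso G H S) (hG : G.IsAcyclic) {p q : V × W}
    (hp : p ∈ S) (hq : q ∈ S) {c : V} (hc : ∀ r ∈ S, r.1 ≠ c) (hcp : G.Adj c p.1)
    (hcq : G.Adj c q.1) : p = q := by
  by_contra hne
  have hne' : p.1 ≠ q.1 := fun h1 => hne (Prod.ext h1 ((h.eq_iff p hp q hq).1 h1))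
  have hb := SimpleGraph.isAcyclic_iff_forall_adj_isBridge.1 hG hcp
  rw [SimpleGraph.isBridge_iff] at hb
  refine hb (SimpleGraph.Reachable.trans (SimpleGraph.Adj.reachable (v := q.1) ?_)
    ((h.reachable_fst q hq p hp (hcq.symm.reachable.trans hcp.reachable)).map
      ⟨Prod.fst, fun {x y} hxy => ?_⟩))
  · rw [SimpleGraph.deleteEdges_adj]
    refine ⟨hcq, ?_⟩
    simp only [Set.mem_singleton_iff, Sym2.eq_iff]
    rintro (⟨-, h2⟩ | ⟨h1, h2⟩)
    · exact hne' h2.symm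
    · exact hc p hp h1.symm
  · rw [SimpleGraph.deleteEdges_adj]
    refine ⟨hxy.2.2.1, ?_⟩
    simp only [Set.mem_singleton_iff, Sym2.eq_iff]
    rintro (⟨h1, -⟩ | ⟨-, h2⟩)
    · exact hc x hxy.1 h1
    · exact hc y hxy.2.1 h2

theorem IsPartialIso.insert_adj (h : IsPartialIso G H S) (hG : G.IsAcyclic) (hH : H.IsAcyclic)
    {p : V × W} (hp : p ∈ S) {c : V} {d : W} (hpc : G.Adj p.1 c) (hpd : H.Adj p.2 d)
    (hc : ∀ r ∈ S, r.1 ≠ c) (hd : ∀ r ∈ S, r.2 ≠ d) : IsPartialIso G H (insert (c, d) S) := by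
  have key : ∀ q ∈ S, G.Adj c q.1 ↔ H.Adj d q.2 := by
    intro q hq
    constructor
    · intro hcq
      rw [← h.fst_eq_of_adj hG hp hq hc hpc.symm hcq]
      exact hpd.symm
    · intro hdq
      have := h.swap.fst_eq_of_adj hH (p := p.swap) (q := q.swap) hp hq
        (fun r hr => hd r.swap hr) hpd.symm hdq
      rw [← Prod.swap_injective this]
      exact hpc.symm
  have hpcd : (commonGraph G H (insert (c, d) S)).Reachable p (c, d) :=
    SimpleGraph.Adj.reachable ⟨Set.mem_insert_of_mem _ hp, Set.mem_insert _ _, hpc, hpd⟩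
  have hmono := commonGraph_mono (G := G) (H := H) (Set.subset_insert (c, d) S)
  refine ⟨h.finite.insert _, ?_, ?_, ?_, ?_⟩
  · rintro q (rfl | hq) r (rfl | hr)
    · simp
    · exact iff_of_false (hc r hr).symm (hd r hr).symm
    · exact iff_of_false (hc q hq) (hd q hq)
    · exact h.eq_iff q hq r hr
  · rintro q (rfl | hq) r (rfl | hr)
    · simp
    · exact key r hr
    · rw [G.adj_comm, H.adj_comm]
      exact key q hq
    · exact h.adj_iff q hq r hr
  · rintro q (rfl | hq) r (rfl | hr) hqr
    · rfl
    · exact hpcd.symm.trans ((h.reachable_fst p hp r hr (hpc.reachable.trans hqr)).mono hmono)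
    · exact ((h.reachable_fst q hq p hp (hqr.trans hpc.symm.reachable)).mono hmono).trans hpcd
    · exact (h.reachable_fst q hq r hr hqr).mono hmono
  · rintro q (rfl | hq) r (rfl | hr) hqr
    · rfl
    · exact hpcd.symm.trans ((h.reachable_snd p hp r hr (hpd.reachable.trans hqr)).mono hmono)
    · exact ((h.reachable_snd q hq p hp (hqr.trans hpd.symm.reachable)).mono hmono).trans hpcd
    · exact (h.reachable_snd q hq r hr hqr).mono hmono

theorem IsPartialIso.insert_not_reachable (h : IsPartialIso G H S) {c : V} {d : W}
    (hc : ∀ r ∈ S, ¬ G.Reachable r.1 c) (hd : ∀ r ∈ S, ¬ H.Reachable r.2 d) :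
    IsPartialIso G H (insert (c, d) S) := by
  have hmono := commonGraph_mono (G := G) (H := H) (Set.subset_insert (c, d) S)
  refine ⟨h.finite.insert _, ?_, ?_, ?_, ?_⟩
  · rintro q (rfl | hq) r (rfl | hr)
    · simp
    · exact iff_of_false (fun e => hc r hr (e ▸ .rfl)) (fun e => hd r hr (e ▸ .rfl))
    · exact iff_of_false (fun e => hc q hq (e ▸ .rfl)) (fun e => hd q hq (e ▸ .rfl))
    · exact h.eq_iff q hq r hr
  · rintro q (rfl | hq) r (rfl | hr)
    · simp
    · exact iff_of_false (fun e => hc r hr e.symm.reachable) (fun e => hd r hr e.symm.reachable)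
    · exact iff_of_false (fun e => hc q hq e.reachable) (fun e => hd q hq e.reachable)
    · exact h.adj_iff q hq r hr
  · rintro q (rfl | hq) r (rfl | hr) hqr
    · rfl
    · exact (hc r hr hqr.symm).elim
    · exact (hc q hq hqr).elim
    · exact (h.reachable_fst q hq r hr hqr).mono hmono
  · rintro q (rfl | hq) r (rfl | hr) hqr
    · rfl
    · exact (hd r hr hqr.symm).elim
    · exact (hd q hq hqr).elim
    · exact (h.reachable_snd q hq r hr hqr).mono hmono

/-- A forest all of whose vertices have infinite degree and which has infinitely many
components. -/
structure IsRichForest (G : SimpleGraph V) : Prop where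
  isAcyclic : G.IsAcyclic
  infinite_neighborSet : ∀ v, (G.neighborSet v).Infinite
  exists_not_reachable : ∀ A : Set V, A.Finite → ∃ v, ∀ a ∈ A, ¬ G.Reachable a v

theorem IsPartialIso.exists_extension_of_reachable (h : IsPartialIso G H S) (hG : IsRichForest G)
    (hH : IsRichForest H) {a c : V} (hac : G.Reachable a c) (ha : ∃ b, (a, b) ∈ S) :
    ∃ S', S ⊆ S' ∧ IsPartialIso G H S' ∧ ∃ d, (c, d) ∈ S' := by
  rw [SimpleGraph.reachable_iff_reflTransGen] at hac
  induction hac with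
  | refl => exact ⟨S, subset_rfl, h, ha⟩
  | @tail b c _ hbc ih =>
    obtain ⟨S', hS, h', b', hb'⟩ := ih
    by_cases hc : ∃ r ∈ S', r.1 = c
    · obtain ⟨r, hr, rfl⟩ := hc
      exact ⟨S', hS, h', r.2, hr⟩
    push Not at hc
    obtain ⟨d, hd, hd'⟩ :=
      ((hH.infinite_neighborSet b').sdiff (h'.finite.image Prod.snd)).nonempty
    exact ⟨_, hS.trans (Set.subset_insert _ _), h'.insert_adj hG.isAcyclic hH.isAcyclic hb' hbc hd
      hc fun r hr e => hd' ⟨r, hr, e⟩, d, Set.mem_insert _ _⟩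

theorem IsPartialIso.exists_extension (h : IsPartialIso G H S) (hG : IsRichForest G)
    (hH : IsRichForest H) (c : V) :
    ∃ S', S ⊆ S' ∧ IsPartialIso G H S' ∧ ∃ d, (c, d) ∈ S' := by
  by_cases hc : ∃ r ∈ S, G.Reachable r.1 c
  · obtain ⟨r, hr, hrc⟩ := hc
    exact h.exists_extension_of_reachable hG hH hrc ⟨r.2, hr⟩
  · push Not at hc
    obtain ⟨d, hd⟩ := hH.exists_not_reachable _ (h.finite.image Prod.snd)
    exact ⟨_, Set.subset_insert _ _, h.insert_not_reachable hc
      fun r hr => hd _ (Set.mem_image_of_mem _ hr), d, Set.mem_insert _ _⟩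

end PartialIso

/-! ### Elementary equivalence of rich forests -/

section ElementaryEquivalence

variable {V W : Type*} [Language.graph.Structure V] [Language.graph.Structure W]
  {S : Set (V × W)}

theorem realize_term_mem {n : ℕ} {v : Empty → V} {w : Empty → W} {x : Fin n → V} {y : Fin n → W}
    (hxy : ∀ i, (x i, y i) ∈ S) (t : Language.graph.Term (Empty ⊕ Fin n)) :
    (t.realize (Sum.elim v x), t.realize (Sum.elim w y)) ∈ S := by
  match t with
  | .var (.inl e) => exact e.elim
  | .var (.inr i) => exact hxy i
  | .func f _ => exact isEmptyElim f

variable [V ⊨ Theory.simpleGraph] [W ⊨ Theory.simpleGraph]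

theorem IsPartialIso.realize_iff
    (hV : IsRichForest (simpleGraphOfStructure V)) (hW : IsRichForest (simpleGraphOfStructure W))
    {n : ℕ} (φ : Language.graph.BoundedFormula Empty n)
    (h : IsPartialIso (simpleGraphOfStructure V) (simpleGraphOfStructure W) S)
    {v : Empty → V} {w : Empty → W} {x : Fin n → V} {y : Fin n → W}
    (hxy : ∀ i, (x i, y i) ∈ S) : φ.Realize v x ↔ φ.Realize w y := by
  induction φ generalizing S with
  | falsum => rfl
  | equal t₁ t₂ => exact h.eq_iff _ (realize_term_mem hxy t₁) _ (realize_term_mem hxy t₂)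
  | @rel n l R ts =>
    cases R
    have := h.adj_iff _ (realize_term_mem (v := v) (w := w) hxy (ts 0)) _
      (realize_term_mem (v := v) (w := w) hxy (ts 1))
    simp only [simpleGraphOfStructure_adj] at this
    simp only [BoundedFormula.Realize]
    convert! this using 2 <;> ext i <;> fin_cases i <;> rfl
  | imp _ _ ih₁ ih₂ => exact imp_congr (ih₁ h hxy) (ih₂ h hxy)
  | all φ ih =>
    have snoc_mem {S' : Set (V × W)} (hS : S ⊆ S') {a : V} {b : W} (hab : (a, b) ∈ S') (i) :
        (Fin.snoc (α := fun _ => V) x a i, Fin.snoc (α := fun _ => W) y b i) ∈ S' := by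
      refine Fin.lastCases ?_ (fun i => ?_) i
      · simpa using hab
      · simpa using hS (hxy i)
    simp only [BoundedFormula.realize_all]
    constructor
    · intro H b
      obtain ⟨S', hS, h', a, hab⟩ := h.swap.exists_extension hW hV b
      exact (ih h'.swap (snoc_mem (fun _ hr => hS hr) hab)).1 (H a)
    · intro H a
      obtain ⟨S', hS, h', b, hab⟩ := h.exists_extension hV hW a
      exact (ih h' (snoc_mem hS hab)).2 (H b)

theorem elementarilyEquivalent_of_isRichForest
    (hV : IsRichForest (simpleGraphOfStructure V)) (hW : IsRichForest (simpleGraphOfStructure W)) :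
    Language.graph.ElementarilyEquivalent V W :=
  elementarilyEquivalent_iff.2 fun φ => isPartialIso_empty.realize_iff hV hW φ fun i => i.elim0

end ElementaryEquivalence

/-! ### Models of `T∞` -/

section Models

variable {V : Type*} [Language.graph.Structure V]

theorem realize_exsTail_s4 {L : Language} {V : Type*} [L.Structure V] {α : Type} {n : ℕ}
    (φ : L.BoundedFormula α (n + 1)) (v : α → V) (xs : Fin 1 → V) :
    (exsTail φ).Realize v xs ↔ ∃ ys : Fin n → V, φ.Realize v (Fin.cons (xs 0) ys) := by
  induction n with
  | zero =>
    have (ys : Fin 0 → V) : (Fin.cons (xs 0) ys : Fin 1 → V) = xs := by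
      ext i
      rw [Fin.fin_one_eq_zero i]
      rfl
    simp [exsTail, this]
  | succ n ih =>
    simp only [exsTail, ih, BoundedFormula.realize_ex, ← Fin.cons_snoc_eq_snoc_cons]
    constructor
    · rintro ⟨ys, a, h⟩
      exact ⟨_, h⟩
    · rintro ⟨ys, h⟩
      refine ⟨Fin.init ys, ys (Fin.last n), ?_⟩
      rwa [Fin.snoc_init_self]

theorem injective_iff_forall_lt {V : Type*} {n : ℕ} {y : Fin n → V} :
    Function.Injective y ↔ ∀ i j, i < j → y i ≠ y j := by
  refine ⟨fun h i j hij e => hij.ne (h e), fun h i j e => ?_⟩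
  by_contra hij
  rcases lt_or_gt_of_ne hij with hij | hij
  exacts [h _ _ hij e, h _ _ hij e.symm]

theorem realize_minDegSentence_s4 (n : ℕ) :
    V ⊨ minDegSentence n ↔
      ∀ x : V, ∃ y : Fin n → V, Function.Injective y ∧ ∀ i, Structure.RelMap adj ![x, y i] := by
  simp only [Sentence.Realize, Formula.Realize, minDegSentence, BoundedFormula.realize_all,
    realize_exsTail_s4, listInf, BoundedFormula.realize_foldr_inf, injective_iff_forall_lt]
  refine forall_congr' fun x => exists_congr fun y => ?_
  rw [List.forall_mem_append, List.forall_mem_map, List.forall_mem_map]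
  simp [Fin.snoc]

theorem realize_noCycleSentence_s4 (n : ℕ) :
    V ⊨ noCycleSentence n ↔
      ¬ ∃ y : Fin n → V, Function.Injective y ∧
        ∀ i, Structure.RelMap adj ![y i, y (finRotate n i)] := by
  simp only [Sentence.Realize, noCycleSentence, Formula.realize_not, BoundedFormula.realize_exs,
    listInf, BoundedFormula.realize_foldr_inf, injective_iff_forall_lt]
  refine not_congr (exists_congr fun y => ?_)
  rw [List.forall_mem_append, List.forall_mem_map, List.forall_mem_map]
  simp

theorem model_Tinf_iff :
    V ⊨ Tinf ↔ V ⊨ Theory.simpleGraph ∧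
      (∀ n, 1 ≤ n → ∀ x : V, ∃ y : Fin n → V, Function.Injective y ∧
        ∀ i, Structure.RelMap adj ![x, y i]) ∧
      ∀ n, 3 ≤ n → ¬ ∃ y : Fin n → V, Function.Injective y ∧
        ∀ i, Structure.RelMap adj ![y i, y (finRotate n i)] := by
  simp_rw [← realize_minDegSentence_s4, ← realize_noCycleSentence_s4]
  simp only [Theory.model_iff, Tinf, Set.mem_union, Set.mem_ofPred_eq]
  constructor
  · intro h
    exact ⟨fun φ hφ => h φ (.inl (.inl hφ)), fun n hn => h _ (.inl (.inr ⟨n, hn, rfl⟩)),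
      fun n hn => h _ (.inr ⟨n, hn, rfl⟩)⟩
  · rintro ⟨h₁, h₂, h₃⟩ φ ((hφ | ⟨n, hn, rfl⟩) | ⟨n, hn, rfl⟩)
    exacts [h₁ φ hφ, h₂ n hn, h₃ n hn]

instance [h : V ⊨ Tinf] : V ⊨ Theory.simpleGraph :=
  (model_Tinf_iff.1 h).1

theorem infinite_neighborSet [h : V ⊨ Tinf] (v : V) :
    ((simpleGraphOfStructure V).neighborSet v).Infinite := by
  intro hfin
  obtain ⟨y, hy, hadj⟩ := (model_Tinf_iff.1 h).2.1
    (((simpleGraphOfStructure V).neighborSet v).ncard + 1) (by lia) v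
  have hle := Set.ncard_le_ncard
    (show Set.range y ⊆ (simpleGraphOfStructure V).neighborSet v by
      rintro _ ⟨i, rfl⟩
      exact hadj i) hfin
  rw [Set.ncard_range_of_injective hy, Nat.card_eq_fintype_card, Fintype.card_fin] at hle
  lia

theorem isAcyclic [h : V ⊨ Tinf] : (simpleGraphOfStructure V).IsAcyclic := by
  intro v c hc
  have h3 := hc.three_le_length
  refine (model_Tinf_iff.1 h).2.2 c.length h3 ⟨fun i => c.getVert i, fun i j hij => ?_,
    fun i => ?_⟩
  · exact Fin.ext (hc.getVert_injOn' (by simp only [Set.mem_ofPred_eq]; lia)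
      (by simp only [Set.mem_ofPred_eq]; lia) hij)
  · have hi := c.adj_getVert_succ i.2
    rw [simpleGraphOfStructure_adj] at hi
    convert! hi using 3
    generalize hn : c.length = n at i
    obtain _ | n := n
    · lia
    · dsimp only
      rw [coe_finRotate]
      split_ifs with hlast
      · rw [hlast, Fin.val_last, ← hn]
        simp
      · rfl

end Models

/-! ### Distant vertices -/

section Distance

variable {V : Type*} {G : SimpleGraph V}

theorem exists_isPath_of_infinite_neighborSet (hG : ∀ v, (G.neighborSet v).Infinite) (v : V)
    (n : ℕ) : ∃ (w : V) (p : G.Walk v w), p.IsPath ∧ p.length = n := by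
  induction n with
  | zero => exact ⟨v, .nil, .nil, rfl⟩
  | succ n ih =>
    obtain ⟨w, p, hp, rfl⟩ := ih
    obtain ⟨u, hu, hu'⟩ := ((hG w).sdiff p.support.finite_toSet).nonempty
    exact ⟨u, p.concat hu, hp.concat hu' hu, p.length_concat hu⟩

theorem exists_edist_eq (hG : ∀ v, (G.neighborSet v).Infinite) (hacyc : G.IsAcyclic) (v : V)
    (n : ℕ) : ∃ w, G.edist v w = n := by
  obtain ⟨w, p, hp, rfl⟩ := exists_isPath_of_infinite_neighborSet hG v n
  obtain ⟨q, hq, hlen⟩ := p.reachable.exists_path_of_dist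
  refine ⟨w, ?_⟩
  have hqp : q = p := congrArg Subtype.val
    ((hacyc.subsingleton_path v w).elim (⟨q, hq⟩ : G.Path v w) ⟨p, hp⟩)
  rw [← p.reachable.coe_dist_eq_edist, ← hlen, hqp]

theorem exists_lt_edist [Nonempty V] (hG : ∀ v, (G.neighborSet v).Infinite)
    (hacyc : G.IsAcyclic) {A : Set V} (hA : A.Finite) (n : ℕ) :
    ∃ w, ∀ a ∈ A, (n : ℕ∞) < G.edist a w := by
  obtain ⟨v⟩ := ‹Nonempty V›
  obtain ⟨B, hB⟩ := (hA.image fun a => (G.edist v a).toNat).bddAbove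
  obtain ⟨w, hw⟩ := exists_edist_eq hG hacyc v (B + n + 1)
  refine ⟨w, fun a ha => ?_⟩
  by_contra! hle
  have h₁ : G.edist v a ≤ (B + n + 1 : ℕ) + n :=
    (G.edist_triangle (v := w)).trans (add_le_add hw.le (G.edist_comm.trans_le hle))
  have h₂ : G.edist v w ≤ G.edist v a + n := (G.edist_triangle (v := a)).trans (by gcongr)
  have h₃ : (G.edist v a).toNat ≤ B := hB ⟨a, ha, rfl⟩
  have htop : ((B + n + 1 : ℕ) + n : ℕ∞) ≠ ⊤ := by
    norm_cast
    exact ENat.natCast_ne_top _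
  lift G.edist v a to ℕ using ne_top_of_le_ne_top htop h₁ with k
  rw [hw] at h₂
  norm_cast at h₂
  rw [ENat.toNat_natCast] at h₃
  lia

end Distance

/-! ### Ultrapowers -/

section Ultrapower

open Filter

variable {M : Type*} {u : Ultrafilter ℕ}

/-- The class of a sequence in the ultrapower. -/
def toUltrapower (u : Ultrafilter ℕ) (x : ℕ → M) : (u : Filter ℕ).Product fun _ => M :=
  Quotient.mk'' (s₁ := (u : Filter ℕ).productSetoid fun _ => M) x

theorem toUltrapower_surjective : Function.Surjective (toUltrapower (M := M) u) :=
  Quotient.mk''_surjective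

theorem toUltrapower_eq_iff {x y : ℕ → M} :
    toUltrapower u x = toUltrapower u y ↔ ∀ᶠ n in u, x n = y n :=
  Quotient.eq''

variable [Language.graph.Structure M] [Nonempty M]

theorem elementarilyEquivalent_ultrapower :
    Language.graph.ElementarilyEquivalent M ((u : Filter ℕ).Product fun _ => M) :=
  elementarilyEquivalent_iff.2 fun φ => by simp [Ultraproduct.sentence_realize]

instance model_ultrapower [h : M ⊨ Tinf] : ((u : Filter ℕ).Product fun _ => M) ⊨ Tinf :=
  elementarilyEquivalent_ultrapower.theory_model

theorem relMap_adj_toUltrapower (x y : ℕ → M) :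
    Structure.RelMap adj ![toUltrapower u x, toUltrapower u y] ↔
      ∀ᶠ n in u, Structure.RelMap adj ![x n, y n] := by
  have := Ultraproduct.realize_formula_cast (u := u) (M := fun _ => M)
    (adj.formula₂ (.var 0) (.var 1) : Language.graph.Formula (Fin 2)) ![x, y]
  simp only [Formula.realize_rel₂, Term.realize_var, Matrix.cons_val_zero,
    Matrix.cons_val_one] at this
  exact this

theorem exists_eventually_edist_le [M ⊨ Tinf] (x y : ℕ → M)
    (h : (simpleGraphOfStructure ((u : Filter ℕ).Product fun _ => M)).Reachable
      (toUltrapower u x) (toUltrapower u y)) :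
    ∃ m : ℕ, ∀ᶠ n in u, (simpleGraphOfStructure M).edist (x n) (y n) ≤ m := by
  rw [SimpleGraph.reachable_iff_reflTransGen] at h
  generalize hz : toUltrapower u y = z at h
  induction h generalizing y with
  | refl => exact ⟨0, (toUltrapower_eq_iff.1 hz).mono fun n hn => by simp [hn]⟩
  | @tail b c _ hbc ih =>
    subst hz
    obtain ⟨b, rfl⟩ := toUltrapower_surjective b
    obtain ⟨m, hm⟩ := ih b rfl
    refine ⟨m + 1, (hm.and ((relMap_adj_toUltrapower b y).1 hbc)).mono fun n hn => ?_⟩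
    refine (SimpleGraph.edist_triangle (v := b n)).trans ?_
    have : (simpleGraphOfStructure M).edist (b n) (y n) = 1 :=
      SimpleGraph.edist_eq_one_iff_adj.2 hn.2
    rw [this]
    push_cast
    gcongr
    exact hn.1

theorem isRichForest_ultrapower [M ⊨ Tinf] (hu : (u : Filter ℕ) ≤ atTop) :
    IsRichForest (simpleGraphOfStructure ((u : Filter ℕ).Product fun _ => M)) where
  isAcyclic := isAcyclic
  infinite_neighborSet := infinite_neighborSet
  exists_not_reachable A hA := by
    choose f hf using toUltrapower_surjective (M := M) (u := u)
    choose y hy using fun n : ℕ => exists_lt_edist (G := simpleGraphOfStructure M)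
      infinite_neighborSet isAcyclic (hA.image fun a => f a n) n
    refine ⟨toUltrapower u y, fun a ha hr => ?_⟩
    rw [← hf a] at hr
    obtain ⟨m, hm⟩ := exists_eventually_edist_le _ y hr
    obtain ⟨n, hn, hmn⟩ := (hm.and (hu (eventually_ge_atTop m))).exists
    have hlt := (hy n _ ⟨a, ha, rfl⟩).trans_le hn
    exact absurd (Nat.cast_lt.1 hlt) (not_lt.2 hmn)

theorem elementarilyEquivalent_of_model {N : Type*} [Language.graph.Structure N] [Nonempty N]
    [M ⊨ Tinf] [N ⊨ Tinf] : Language.graph.ElementarilyEquivalent M N :=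
  (elementarilyEquivalent_ultrapower (u := hyperfilter ℕ)).trans <|
    (elementarilyEquivalent_of_isRichForest (isRichForest_ultrapower Nat.hyperfilter_le_atTop)
      (isRichForest_ultrapower Nat.hyperfilter_le_atTop)).trans
    (elementarilyEquivalent_ultrapower (u := hyperfilter ℕ)).symm

end Ultrapower

/-! ### Existence of a model -/

section Existence

/-- The tree of finite sequences of natural numbers. -/
def listTree : SimpleGraph (List ℕ) where
  Adj x y := (∃ a, x = a :: y) ∨ ∃ a, y = a :: x
  symm := ⟨fun _ _ h => h.symm⟩
  loopless := ⟨fun x => by simp⟩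

theorem listTree_eq_tail {x y : List ℕ} (h : listTree.Adj x y) (hle : y.length ≤ x.length) :
    y = x.tail := by
  obtain ⟨a, rfl⟩ | ⟨a, rfl⟩ := h
  · rfl
  · simp at hle

theorem Tinf_isSatisfiable : Tinf.IsSatisfiable := by
  let := listTree.structure
  suffices List ℕ ⊨ Tinf from Theory.Model.isSatisfiable (List ℕ)
  refine model_Tinf_iff.2 ⟨inferInstance, fun n _ x => ?_, ?_⟩
  · exact ⟨fun i => (i : ℕ) :: x, fun i j h => by simpa [Fin.ext_iff] using h,
      fun i => .inr ⟨i, rfl⟩⟩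
  · rintro n hn ⟨y, hy, hadj⟩
    replace hadj : ∀ i, listTree.Adj (y i) (y (finRotate n i)) := hadj
    obtain ⟨n, rfl⟩ := Nat.exists_eq_add_of_le' hn
    obtain ⟨i, hi⟩ := Finite.exists_max fun i => (y i).length
    have h₁ := listTree_eq_tail (hadj i) (hi _)
    have h₂ := hadj ((finRotate _).symm i)
    rw [Equiv.apply_symm_apply] at h₂
    have h₃ := hy (h₁.trans (listTree_eq_tail h₂.symm (hi _)).symm)
    rw [finRotate_apply, finRotate_symm_apply, eq_sub_iff_add_eq, add_assoc, add_eq_left,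
      Fin.ext_iff] at h₃
    simp [Fin.val_add, Nat.mod_eq_of_lt] at h₃

end Existence

/-- The theory `T∞` is complete: it is satisfiable, and every sentence
of the language of graphs is either a consequence of `T∞` or its negation is. -/
theorem Tinf_isComplete : Tinf.IsComplete := by
  rw [Theory.IsComplete.isComplete_iff_models_elementarily_equivalent]
  exact ⟨Tinf_isSatisfiable, fun M N => elementarilyEquivalent_of_model⟩

end InfiniteBranchingTree
end

section
/- Let d, g : ℕ → ℕ be non-decreasing unbounded functions, let (H_k) be a sequence of finite simple graphs such that each H_k is d(k)-regular and has girth ≥ g(k), and let U be a nonprincipal ultrafilter on ℕ. Then for every first-order graph formula φ(x, y₁,…,yₘ) with one object variable x and every choice of parameter tuples ā_k ∈ H_kᵐ (k ∈ ℕ), there exists a polynomial p ∈ ℤ[t₁,t₂] such that the set { k ∈ ℕ : the number of x ∈ H_k satisfying φ(x, ā_k) equals p(|H_k|, d(k)) } belongs to U. (Equivalently: in the ultraproduct M = ∏_U H_k, which is a model of T∞, every definable subset of M¹ has nonstandard cardinality p(α,β), where α = [|H_k|]_U and β = [d(k)]_U.) -/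
open FirstOrder Language

namespace InfiniteBranchingTree

/-- Up to distance `M` from any vertex `a`, every vertex other than `a` has exactly one neighbor
closer to `a`, and all its other neighbors are farther from `a`. -/
def IsLocallyTree {V : Type*} (G : SimpleGraph V) (M : ℕ) : Prop :=
  ∀ ⦃v a : V⦄ ⦃c : ℕ⦄, c < M → G.edist v a = (c + 1 : ℕ) →
    ∃ u, G.Adj v u ∧ G.edist u a = c ∧
      ∀ w, G.Adj v w → w ≠ u → G.edist w a = (c + 2 : ℕ)

section Girth

variable {V : Type*} {G : SimpleGraph V}

theorem exists_isPath_of_edist_eq {u v : V} {c : ℕ} (h : G.edist u v = c) :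
    ∃ p : G.Walk u v, p.IsPath ∧ p.length = c := by
  classical
  obtain ⟨p, hp⟩ := G.exists_walk_of_edist_eq_coe h
  refine ⟨p.bypass, p.bypass_isPath, le_antisymm (hp ▸ p.length_bypass_le_length) ?_⟩
  have := G.edist_le p.bypass
  rw [h] at this
  exact_mod_cast this

theorem isPath_eq_of_length_add_lt_egirth {u v : V} {p q : G.Walk u v} (hp : p.IsPath)
    (hq : q.IsPath) (h : ((p.length + q.length : ℕ) : ℕ∞) < G.egirth) : p = q := by
  classical
  let E : Finset (Sym2 V) := p.edges.toFinset ∪ q.edges.toFinset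
  let G' : SimpleGraph V := SimpleGraph.fromEdgeSet (E : Set (Sym2 V))
  have hE : E.card ≤ p.length + q.length := by
    refine (Finset.card_union_le _ _).trans (add_le_add ?_ ?_)
    · simpa using p.edges.toFinset_card_le
    · simpa using q.edges.toFinset_card_le
  have hmem : ∀ e ∈ E, e ∈ G.edgeSet := by
    intro e he
    rcases Finset.mem_union.1 he with he | he
    · exact p.edges_subset_edgeSet (List.mem_toFinset.1 he)
    · exact q.edges_subset_edgeSet (List.mem_toFinset.1 he)
  have hG' : G'.edgeSet ⊆ (E : Set (Sym2 V)) := by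
    rw [SimpleGraph.edgeSet_fromEdgeSet]
    exact Set.sdiff_subset
  have hle : G' ≤ G := by
    rw [← SimpleGraph.edgeSet_subset_edgeSet]
    exact fun e he => hmem e (hG' he)
  have hmem' : ∀ e ∈ E, e ∈ G'.edgeSet := by
    intro e he
    rw [SimpleGraph.edgeSet_fromEdgeSet]
    exact ⟨he, G.not_isDiag_of_mem_edgeSet (hmem e he)⟩
  have hacyc : G'.IsAcyclic := by
    intro a w hw
    have h1 : w.length ≤ E.card := by
      rw [← w.length_edges, ← List.toFinset_card_of_nodup hw.edges_nodup]
      exact Finset.card_le_card fun e he =>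
        hG' (w.edges_subset_edgeSet (List.mem_toFinset.1 he))
    have h2 := SimpleGraph.egirth_le_length (hw.mapLe hle)
    rw [SimpleGraph.Walk.length_map] at h2
    have h3 : ((p.length + q.length : ℕ) : ℕ∞) < (w.length : ℕ∞) := h.trans_le h2
    have h4 : p.length + q.length < w.length := by exact_mod_cast h3
    omega
  have hp' : ∀ e ∈ p.edges, e ∈ G'.edgeSet := fun e he =>
    hmem' e (Finset.mem_union_left _ (List.mem_toFinset.2 he))
  have hq' : ∀ e ∈ q.edges, e ∈ G'.edgeSet := fun e he =>
    hmem' e (Finset.mem_union_right _ (List.mem_toFinset.2 he))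
  have key := congrArg Subtype.val
    ((hacyc.subsingleton_path u v).elim ⟨p.transfer G' hp', hp.transfer hp'⟩
      ⟨q.transfer G' hq', hq.transfer hq'⟩)
  apply SimpleGraph.Walk.ext_support
  simpa using congrArg SimpleGraph.Walk.support key

theorem isLocallyTree_of_le_egirth {M : ℕ} (h : ((2 * M + 2 : ℕ) : ℕ∞) ≤ G.egirth) :
    IsLocallyTree G M := by
  classical
  intro v a c hc hva
  have huniq : ∀ {u v : V} {p q : G.Walk u v}, p.IsPath → q.IsPath →
      p.length + q.length < 2 * M + 2 → p = q := fun hp hq hl =>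
    isPath_eq_of_length_add_lt_egirth hp hq (lt_of_lt_of_le (by exact_mod_cast hl) h)
  have hdist : ∀ q : G.Walk v a, c + 1 ≤ q.length := by
    intro q
    have := G.edist_le q
    rw [hva] at this
    exact_mod_cast this
  have hcons : ∀ {w : V} (q : G.Walk w a), q.length ≤ c + 1 → v ≠ w → v ∉ q.support := by
    intro w q hq hne hv
    have h1 := congrArg SimpleGraph.Walk.length (q.take_spec hv)
    rw [SimpleGraph.Walk.length_append] at h1
    have h2 := hdist (q.dropUntil v hv)
    exact hne (SimpleGraph.Walk.eq_of_length_eq_zero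
      (p := q.takeUntil v hv) (by omega)).symm
  obtain ⟨p, hp, hpl⟩ := exists_isPath_of_edist_eq hva
  cases p with
  | nil => simp at hpl
  | @cons _ u _ hvu p =>
    have hpl' : p.length = c := by simpa using hpl
    refine ⟨u, hvu, ?_, ?_⟩
    · have h1 := G.edist_le p
      have h2 := G.edist_triangle (u := v) (v := u) (w := a)
      rw [hva, SimpleGraph.edist_eq_one_iff_adj.2 hvu] at h2
      rw [hpl'] at h1
      obtain ⟨e, he, hec⟩ := ENat.le_natCast_iff.1 h1
      rw [he] at h2 ⊢
      norm_cast at h2 ⊢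
      omega
    · intro w hvw hwu
      have h1 := G.edist_triangle (u := v) (v := w) (w := a)
      have h2 := G.edist_triangle (u := w) (v := v) (w := a)
      rw [hva, SimpleGraph.edist_eq_one_iff_adj.2 hvw] at h1
      rw [hva, SimpleGraph.edist_eq_one_iff_adj.2 hvw.symm] at h2
      have h3 : G.edist w a ≤ (c + 2 : ℕ) := h2.trans (by norm_cast; omega)
      obtain ⟨e, he, hec⟩ := ENat.le_natCast_iff.1 h3
      rw [he] at h1 ⊢
      norm_cast at h1 ⊢
      by_contra hne
      obtain ⟨q, hq, hql⟩ := exists_isPath_of_edist_eq he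
      have h4 : (SimpleGraph.Walk.cons hvw q).IsPath :=
        hq.cons (hcons q (by omega) hvw.ne)
      have h5 := huniq hp h4 (by simp; omega)
      simp only [SimpleGraph.Walk.cons.injEq] at h5
      exact hwu h5.1.symm

end Girth

section LocallyTree

variable {V : Type*} {G : SimpleGraph V} {M : ℕ}

theorem edist_le_of_edist_eq {x a b : V} {s t : ℕ} (ha : G.edist x a = s) (hb : G.edist x b = t) :
    ∃ e ≤ s + t, G.edist a b = e := by
  have h := G.edist_triangle (u := a) (v := x) (w := b)
  rw [G.edist_comm (u := a) (v := x), ha, hb, ← Nat.cast_add] at h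
  obtain ⟨e, he, hec⟩ := ENat.le_natCast_iff.1 h
  exact ⟨e, hec, he⟩

namespace IsLocallyTree

theorem closer_unique (hG : IsLocallyTree G M) {v a u w : V} {c : ℕ} (hc : c < M)
    (hv : G.edist v a = (c + 1 : ℕ)) (hvu : G.Adj v u) (hu : G.edist u a = c)
    (hvw : G.Adj v w) (hw : G.edist w a = c) : u = w := by
  obtain ⟨z, -, -, hz⟩ := hG hc hv
  have aux : ∀ y, G.Adj v y → G.edist y a = c → y = z := by
    intro y hy hya
    by_contra hne
    have := hz y hy hne
    rw [hya] at this
    norm_cast at this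
    omega
  rw [aux u hvu hu, aux w hvw hw]

theorem adj_edist (hG : IsLocallyTree G M) {y z a : V} {c : ℕ} (hc : c ≤ M) (hyz : G.Adj y z)
    (hz : G.edist z a = c) :
    G.edist y a = (c + 1 : ℕ) ∨ ∃ s, c = s + 1 ∧ G.edist y a = s := by
  rcases c with _ | s
  · left
    have : z = a := by simpa using hz
    subst this
    simpa using SimpleGraph.edist_eq_one_iff_adj.2 hyz
  · obtain ⟨u, hu, hua, hw⟩ := hG hc hz
    by_cases h : y = u
    · exact Or.inr ⟨s, rfl, h ▸ hua⟩
    · exact Or.inl (hw y hyz.symm h)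

theorem edist_eq_add (hG : IsLocallyTree G M) {x u a b : V} {n t : ℕ} (hM : n + t ≤ M)
    (hxu : G.Adj x u) (hxa : G.edist x a = n) (hua : G.edist u a = (n + 1 : ℕ))
    (hub : G.edist u b = t) (hxb : G.edist x b = (t + 1 : ℕ)) :
    G.edist a b = (n + 1 + t : ℕ) := by
  induction t generalizing x u n with
  | zero =>
    have : u = b := by simpa using hub
    subst this
    rw [G.edist_comm]
    exact hua
  | succ t ih =>
    obtain ⟨y, huy, hyb, -⟩ := hG (by omega) hub
    have hyx : y ≠ x := by
      rintro rfl
      rw [hyb] at hxb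
      norm_cast at hxb
      omega
    have hya : G.edist y a = (n + 1 + 1 : ℕ) := by
      obtain ⟨w, huw, hwa, hw⟩ := hG (by omega) hua
      refine hw y huy ?_
      rintro rfl
      exact hyx (hG.closer_unique (by omega) hua huw hwa hxu.symm hxa)
    rw [ih (by omega) huy hua hya hyb hub]
    norm_cast
    omega

theorem eq_of_edist_eq_add (hG : IsLocallyTree G M) {x x' a b : V} {s t : ℕ} (hM : s + t ≤ M)
    (hab : G.edist a b = (s + t : ℕ)) (hxa : G.edist x a = s) (hxb : G.edist x b = t)
    (hxa' : G.edist x' a = s) (hxb' : G.edist x' b = t) : x = x' := by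
  induction s generalizing x x' t with
  | zero =>
    have h1 : x = a := by simpa using hxa
    have h2 : x' = a := by simpa using hxa'
    rw [h1, h2]
  | succ s ih =>
    have step : ∀ {x : V}, G.edist x a = (s + 1 : ℕ) → G.edist x b = t →
        ∃ u, G.Adj u x ∧ G.edist u a = s ∧ G.edist u b = (t + 1 : ℕ) := by
      intro x hxa hxb
      obtain ⟨u, hu, hua, -⟩ := hG (by omega) hxa
      refine ⟨u, hu.symm, hua, ?_⟩
      rcases hG.adj_edist (by omega) hu.symm hxb with h | ⟨r, rfl, h⟩
      · exact h
      · obtain ⟨e, he, hab'⟩ := edist_le_of_edist_eq hua h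
        rw [hab'] at hab
        norm_cast at hab
        omega
    obtain ⟨u, hux, hua, hub⟩ := step hxa hxb
    obtain ⟨u', hux', hua', hub'⟩ := step hxa' hxb'
    have : u = u' := ih (t := t + 1) (by omega) (by rw [hab]; norm_cast; omega) hua hub hua' hub'
    subst this
    exact hG.closer_unique (by omega) hub hux hxb hux' hxb'

/-- A vertex with more neighbors than there are points `f i` has a neighbor that is not closer to
any of these points. -/
theorem exists_adj_not_closer [Finite V] (hG : IsLocallyTree G M) {ι : Type*} [Fintype ι]
    (f : ι → V) (y : V) (hd : Fintype.card ι < (G.neighborSet y).ncard) :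
    ∃ z, G.Adj y z ∧
      ∀ i, ∀ c < M, ¬(G.edist z (f i) = c ∧ G.edist y (f i) = (c + 1 : ℕ)) := by
  classical
  have : ∀ i, ∃ h : V, ∀ z, G.Adj y z →
      ∀ c < M, G.edist z (f i) = c → G.edist y (f i) = (c + 1 : ℕ) → z = h := by
    intro i
    by_cases H : ∃ z c, G.Adj y z ∧ c < M ∧ G.edist z (f i) = c ∧ G.edist y (f i) = (c + 1 : ℕ)
    · obtain ⟨z, c, hyz, hc, h1, h2⟩ := H
      refine ⟨z, fun w hw c' hc' h1' h2' => ?_⟩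
      have : c' = c := by
        rw [h2'] at h2
        norm_cast at h2
        omega
      subst this
      exact hG.closer_unique hc h2 hw h1' hyz h1
    · exact ⟨y, fun z hz c hc h1 h2 => (H ⟨z, c, hz, hc, h1, h2⟩).elim⟩
  choose h hh using this
  obtain ⟨z, hz, hzh⟩ : ∃ z ∈ G.neighborSet y, z ∉ Set.range h := by
    by_contra! hcon
    have h1 := Set.ncard_le_ncard (s := G.neighborSet y) (t := Set.range h) hcon
      (Set.finite_range h)
    have h2 : (Set.range h).ncard ≤ Fintype.card ι := by
      rw [← Set.image_univ, ← Nat.card_eq_fintype_card, ← Set.ncard_univ]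
      exact Set.ncard_image_le
    omega
  exact ⟨z, hz, fun i c hc hcl => hzh ⟨i, (hh i z hz c hc hcl.1 hcl.2).symm⟩⟩

theorem exists_far [Finite V] (hG : IsLocallyTree G M) {ι : Type*} [Fintype ι]
    (f : ι → V) (hd : ∀ y, Fintype.card ι < (G.neighborSet y).ncard) (y : V) (s : ℕ)
    (hs : s ≤ M) : ∃ y' : V, ∀ i, ∀ c < s, G.edist y' (f i) ≠ c := by
  induction s with
  | zero => exact ⟨y, fun i c hc => by omega⟩
  | succ s ih =>
    obtain ⟨w, hw⟩ := ih (by omega)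
    obtain ⟨z, hwz, hz⟩ := hG.exists_adj_not_closer f w (hd w)
    refine ⟨z, fun i c hc hzc => ?_⟩
    rcases hG.adj_edist (by omega) hwz hzc with h | ⟨r, rfl, h⟩
    · exact hz i c (by omega) ⟨hzc, h⟩
    · exact hw i r (by omega) h

end IsLocallyTree

end LocallyTree

section BackAndForth

variable {V : Type*} {G : SimpleGraph V} {M : ℕ} {ι : Type*}

/-- The points `y` and `y'` have the same distances up to `R` to the tuples `f` and `f'`. -/
def SamePosition (G : SimpleGraph V) (R : ℕ) (f f' : ι → V) (y y' : V) : Prop :=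
  ∀ i, ∀ c ≤ R, G.edist y (f i) = c ↔ G.edist y' (f' i) = c

/-- The tuples `f` and `f'` have the same pairwise distances up to `R`. -/
def SameShape (G : SimpleGraph V) (R : ℕ) (f f' : ι → V) : Prop :=
  ∀ i, SamePosition G R f f' (f i) (f' i)

theorem SamePosition.symm {R : ℕ} {f f' : ι → V} {y y' : V} (h : SamePosition G R f f' y y') :
    SamePosition G R f' f y' y :=
  fun i c hc => (h i c hc).symm

theorem SamePosition.mono {R S : ℕ} (hRS : R ≤ S) {f f' : ι → V} {y y' : V}
    (h : SamePosition G S f f' y y') : SamePosition G R f f' y y' :=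
  fun i c hc => h i c (hc.trans hRS)

theorem SameShape.symm {R : ℕ} {f f' : ι → V} (h : SameShape G R f f') : SameShape G R f' f :=
  fun i => (h i).symm

theorem SameShape.mono {R S : ℕ} (hRS : R ≤ S) {f f' : ι → V} (h : SameShape G S f f') :
    SameShape G R f f' :=
  fun i => (h i).mono hRS

namespace IsLocallyTree

theorem edist_eq_of_no_closer (hG : IsLocallyTree G M) {R : ℕ} (hR : R ≤ M) {f f' : ι → V}
    {y y' z z' : V} (hyz : G.Adj y z) (hyz' : G.Adj y' z')
    (hy : SamePosition G (R + 1) f f' y y')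
    (hz : ∀ i, ∀ c ≤ R, ¬(G.edist z (f i) = c ∧ G.edist y (f i) = (c + 1 : ℕ)))
    (hz' : ∀ i, ∀ c ≤ R, ¬(G.edist z' (f' i) = c ∧ G.edist y' (f' i) = (c + 1 : ℕ)))
    (i : ι) (c : ℕ) (hc : c ≤ R) (hzc : G.edist z (f i) = c) : G.edist z' (f' i) = c := by
  rcases hG.adj_edist (by omega) hyz hzc with h | ⟨s, rfl, h⟩
  · exact (hz i c hc ⟨hzc, h⟩).elim
  · have h' := (hy i s (by omega)).1 h
    rcases hG.adj_edist (by omega) hyz'.symm h' with h2 | ⟨r, rfl, h2⟩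
    · exact h2
    · exact (hz' i r (by omega) ⟨h2, h'⟩).elim

theorem edist_eq_of_closer (hG : IsLocallyTree G M) {R : ℕ} (hR : 2 * R + 1 ≤ M) {f f' : ι → V}
    (hf : SameShape G (2 * R) f f') {y y' z z' : V} (hyz : G.Adj y z) (hyz' : G.Adj y' z')
    (hy : SamePosition G (R + 1) f f' y y') {j : ι} {r : ℕ} (hr : r ≤ R)
    (hzj : G.edist z (f j) = r) (hyj : G.edist y (f j) = (r + 1 : ℕ))
    (hzj' : G.edist z' (f' j) = r) (hyj' : G.edist y' (f' j) = (r + 1 : ℕ))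
    (i : ι) (c : ℕ) (hc : c ≤ R) (hzc : G.edist z (f i) = c) : G.edist z' (f' i) = c := by
  rcases hG.adj_edist (by omega) hyz hzc with h | ⟨s, rfl, h⟩
  · have h' := (hy i (c + 1) (by omega)).1 h
    rcases hG.adj_edist (by omega) hyz'.symm h' with h2 | ⟨t, ht, h2⟩
    · obtain ⟨e, he, hab⟩ := edist_le_of_edist_eq hzc hzj
      rw [hf i j e (by omega)] at hab
      have := hG.edist_eq_add (by omega) hyz' h' h2 hzj' hyj'
      rw [hab] at this
      norm_cast at this
      omega
    · obtain rfl : c = t := by omega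
      exact h2
  · have h' := (hy i s (by omega)).1 h
    rcases hG.adj_edist (by omega) hyz'.symm h' with h2 | ⟨t, rfl, h2⟩
    · exact h2
    · have hab := hG.edist_eq_add (by omega) hyz h hzc hzj hyj
      obtain ⟨e, he, hab'⟩ := edist_le_of_edist_eq h2 hzj'
      rw [← hf i j e (by omega), hab] at hab'
      norm_cast at hab'
      omega

theorem exists_adj_samePosition [Finite V] [Fintype ι] (hG : IsLocallyTree G M)
    (hd : ∀ y, Fintype.card ι < (G.neighborSet y).ncard) {R : ℕ} (hR : 2 * R + 1 ≤ M)
    {f f' : ι → V} (hf : SameShape G (2 * R) f f') {y y' z : V} (hyz : G.Adj y z)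
    (hy : SamePosition G (R + 1) f f' y y') : ∃ z', SamePosition G R f f' z z' := by
  by_cases H : ∃ j, ∃ r ≤ R, G.edist z (f j) = r ∧ G.edist y (f j) = (r + 1 : ℕ)
  · obtain ⟨j, r, hr, hzj, hyj⟩ := H
    have hyj' := (hy j (r + 1) (by omega)).1 hyj
    obtain ⟨z', hyz', hzj', -⟩ := hG (by omega) hyj'
    exact ⟨z', fun i c hc =>
      ⟨hG.edist_eq_of_closer hR hf hyz hyz' hy hr hzj hyj hzj' hyj' i c hc,
        hG.edist_eq_of_closer hR hf.symm hyz' hyz hy.symm hr hzj' hyj' hzj hyj i c hc⟩⟩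
  · push Not at H
    have H1 : ∀ i, ∀ c ≤ R, ¬(G.edist z (f i) = c ∧ G.edist y (f i) = (c + 1 : ℕ)) :=
      fun i c hc h => H i c hc h.1 h.2
    obtain ⟨z', hyz', hz'⟩ := hG.exists_adj_not_closer f' y' (hd y')
    have H2 : ∀ i, ∀ c ≤ R, ¬(G.edist z' (f' i) = c ∧ G.edist y' (f' i) = (c + 1 : ℕ)) :=
      fun i c hc => hz' i c (by omega)
    exact ⟨z', fun i c hc => ⟨hG.edist_eq_of_no_closer (by omega) hyz hyz' hy H1 H2 i c hc,
      hG.edist_eq_of_no_closer (by omega) hyz' hyz hy.symm H2 H1 i c hc⟩⟩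

theorem exists_samePosition_of_edist_eq [Finite V] [Fintype ι] (hG : IsLocallyTree G M)
    (hd : ∀ y, Fintype.card ι < (G.neighborSet y).ncard) {f f' : ι → V} {i : ι} (t : ℕ) {R : ℕ}
    (hR : 2 * (R + t) + 1 ≤ M) (hf : SameShape G (2 * (R + t)) f f') {y : V}
    (hy : G.edist y (f i) = t) : ∃ y', SamePosition G R f f' y y' := by
  induction t generalizing R y with
  | zero =>
    have : y = f i := by simpa using hy
    subst this
    exact ⟨f' i, (hf i).mono (by omega)⟩
  | succ t ih =>
    obtain ⟨w, hyw, hw, -⟩ := hG (by omega) hy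
    obtain ⟨w', hw'⟩ := ih (R := R + 1) (by omega) (hf.mono (by omega)) hw
    exact hG.exists_adj_samePosition hd (by omega) (hf.mono (by omega)) hyw.symm hw'

theorem exists_samePosition [Finite V] [Fintype ι] (hG : IsLocallyTree G M)
    (hd : ∀ y, Fintype.card ι < (G.neighborSet y).ncard) {R : ℕ} (hR : 4 * R + 1 ≤ M)
    {f f' : ι → V} (hf : SameShape G (4 * R) f f') (y : V) :
    ∃ y', SamePosition G R f f' y y' := by
  by_cases H : ∃ i, ∃ t ≤ R, G.edist y (f i) = t
  · obtain ⟨i, t, ht, hy⟩ := H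
    exact hG.exists_samePosition_of_edist_eq hd t (by omega) (hf.mono (by omega)) hy
  · push Not at H
    obtain ⟨y', hy'⟩ := hG.exists_far f' hd y (R + 1) (by omega)
    exact ⟨y', fun i c hc => iff_of_false (H i c hc) (hy' i c (by omega))⟩

end IsLocallyTree

theorem term_eq_var {α : Type*} (t : Language.graph.Term α) : ∃ a, t = Term.var a := by
  cases t with
  | var a => exact ⟨a, rfl⟩
  | func f _ => exact isEmptyElim f

theorem SameShape.sumElim_snoc {m n R : ℕ} {v v' : Fin m → V} {xs xs' : Fin n → V} {y y' : V}
    (h : SameShape G R (Sum.elim v xs) (Sum.elim v' xs'))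
    (hy : SamePosition G R (Sum.elim v xs) (Sum.elim v' xs') y y') :
    SameShape G R (Sum.elim v (Fin.snoc xs y : Fin (n + 1) → V))
      (Sum.elim v' (Fin.snoc xs' y' : Fin (n + 1) → V)) := by
  have aux : ∀ {z z' : V}, SamePosition G R (Sum.elim v xs) (Sum.elim v' xs') z z' →
      (∀ c ≤ R, G.edist z y = c ↔ G.edist z' y' = c) →
      SamePosition G R (Sum.elim v (Fin.snoc xs y : Fin (n + 1) → V))
        (Sum.elim v' (Fin.snoc xs' y' : Fin (n + 1) → V)) z z' := by
    intro z z' hz hzy i c hc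
    rcases i with i | i
    · exact hz (Sum.inl i) c hc
    · refine Fin.lastCases ?_ (fun i => ?_) i
      · simpa using hzy c hc
      · simpa using hz (Sum.inr i) c hc
  have aux' : ∀ i, ∀ c ≤ R, G.edist (Sum.elim v xs i) y = c ↔
      G.edist (Sum.elim v' xs' i) y' = c := by
    intro i c hc
    rw [G.edist_comm, G.edist_comm (u := Sum.elim v' xs' i)]
    exact hy i c hc
  intro i
  rcases i with i | i
  · exact aux (h (Sum.inl i)) (aux' (Sum.inl i))
  · refine Fin.lastCases ?_ (fun i => ?_) i
    · simpa using aux hy (fun c _ => by simp)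
    · simpa using aux (h (Sum.inr i)) (aux' (Sum.inr i))

/-- In locally tree-like graphs of large minimum degree, the truth of a formula only depends on
the distances between its arguments, up to some bound. -/
theorem exists_realize_iff_of_sameShape {m n : ℕ} (φ : Language.graph.BoundedFormula (Fin m) n) :
    ∃ R D M : ℕ, ∀ (V : Type) [Finite V] (G : SimpleGraph V), IsLocallyTree G M →
      (∀ y, D < (G.neighborSet y).ncard) → ∀ (v v' : Fin m → V) (xs xs' : Fin n → V),
      SameShape G R (Sum.elim v xs) (Sum.elim v' xs') →
      haveI := G.structure
      (φ.Realize v xs ↔ φ.Realize v' xs') := by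
  induction φ with
  | falsum => exact ⟨0, 0, 0, fun V _ G _ _ v v' xs xs' _ => Iff.rfl⟩
  | equal t₁ t₂ =>
    obtain ⟨i, rfl⟩ := term_eq_var t₁
    obtain ⟨j, rfl⟩ := term_eq_var t₂
    refine ⟨0, 0, 0, fun V _ G _ _ v v' xs xs' h => ?_⟩
    simpa [BoundedFormula.Realize] using h i j 0 le_rfl
  | rel r ts =>
    cases r with
    | adj =>
    obtain ⟨i, hi⟩ := term_eq_var (ts 0)
    obtain ⟨j, hj⟩ := term_eq_var (ts 1)
    refine ⟨1, 0, 0, fun V _ G _ _ v v' xs xs' h => ?_⟩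
    have := h i j 1 le_rfl
    simp only [Nat.cast_one, SimpleGraph.edist_eq_one_iff_adj] at this
    simpa [BoundedFormula.Realize, Structure.RelMap, hi, hj] using this
  | imp φ ψ ih₁ ih₂ =>
    obtain ⟨R₁, D₁, M₁, h₁⟩ := ih₁
    obtain ⟨R₂, D₂, M₂, h₂⟩ := ih₂
    refine ⟨max R₁ R₂, max D₁ D₂, max M₁ M₂, fun V _ G hG hd v v' xs xs' h => ?_⟩
    have e₁ := h₁ V G (fun _ _ _ hc => hG (by omega)) (fun y => by have := hd y; omega) v v' xs xs'
      (h.mono (by omega))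
    have e₂ := h₂ V G (fun _ _ _ hc => hG (by omega)) (fun y => by have := hd y; omega) v v' xs xs'
      (h.mono (by omega))
    simp only [BoundedFormula.realize_imp]
    rw [e₁, e₂]
  | @all n φ ih =>
    obtain ⟨R, D, M, h⟩ := ih
    refine ⟨4 * R, max D (m + n), max M (4 * R + 1), fun V _ G hG hd v v' xs xs' hx => ?_⟩
    have hd' : ∀ y, Fintype.card (Fin m ⊕ Fin n) < (G.neighborSet y).ncard := by
      intro y
      have := hd y
      simp only [Fintype.card_sum, Fintype.card_fin]
      omega
    have key : ∀ {v v' : Fin m → V} {xs xs' : Fin n → V} {y y' : V},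
        SameShape G (4 * R) (Sum.elim v xs) (Sum.elim v' xs') →
        SamePosition G R (Sum.elim v xs) (Sum.elim v' xs') y y' →
        haveI := G.structure
        (φ.Realize v (Fin.snoc xs y) ↔ φ.Realize v' (Fin.snoc xs' y')) := fun hx hy =>
      h V G (fun _ _ _ hc => hG (by omega)) (fun y => by have := hd y; omega) _ _ _ _
        ((hx.mono (by omega)).sumElim_snoc hy)
    simp only [BoundedFormula.realize_all]
    constructor
    · intro H y
      obtain ⟨y', hy'⟩ := hG.exists_samePosition hd' (by omega) hx.symm y
      exact (key hx.symm hy').2 (H y')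
    · intro H y
      obtain ⟨y', hy'⟩ := hG.exists_samePosition hd' (by omega) hx y
      exact (key hx hy').2 (H y')

end BackAndForth

section Counting

variable {V : Type*} {G : SimpleGraph V} {M : ℕ} {ι : Type*}

/-- The set of vertices having prescribed distances `c i` to the points `a i`. -/
def sphereInter (G : SimpleGraph V) (a : ι → V) (c : ι → ℕ) : Set V :=
  {x | ∀ i, G.edist x (a i) = c i}

namespace IsLocallyTree

theorem exists_adj_mem_sphereInter (hG : IsLocallyTree G M) [Nonempty ι] {a : ι → V} {c : ι → ℕ}
    (hc : ∀ i j, c i + c j + 2 ≤ M) (h : (sphereInter G a (fun i => c i + 1)).Nontrivial) {x : V}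
    (hx : x ∈ sphereInter G a (fun i => c i + 1)) : ∃ u ∈ sphereInter G a c, G.Adj x u := by
  obtain ⟨i⟩ := ‹Nonempty ι›
  obtain ⟨u, hxu, hui, -⟩ := hG (by have := hc i i; omega) (hx i)
  refine ⟨u, fun j => ?_, hxu⟩
  have := hc i j
  have hxj : G.edist x (a j) = (c j + 1 : ℕ) := hx j
  rcases hG.adj_edist (by omega) hxu.symm hxj with h2 | ⟨s, hs, h2⟩
  · exfalso
    have h3 := hG.edist_eq_add (by omega) hxu hxj h2 hui (hx i)
    obtain ⟨x', hx', hne⟩ := h.exists_ne x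
    refine hne (hG.eq_of_edist_eq_add (M := M) (s := c j + 1) (t := c i + 1) (by omega) ?_ (hx' j)
      (hx' i) (hx j) (hx i))
    rw [h3]
    norm_cast
    omega
  · obtain rfl : c j = s := by omega
    exact h2

theorem subsingleton_sphereInter {a : ι → V} {c : ι → ℕ} {i : ι} (hi : c i = 0) :
    (sphereInter G a c).Subsingleton := by
  have : ∀ x ∈ sphereInter G a c, x = a i := by
    intro x hx
    simpa [hi] using hx i
  intro x hx y hy
  rw [this x hx, this y hy]

/-- All but at most `card ι` neighbors of a vertex of `sphereInter G a c` are farther from every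
`a i`. -/
theorem ncard_adj_inter_sphereInter [Finite V] [Fintype ι] [Nonempty ι] (hG : IsLocallyTree G M)
    {a : ι → V} {c : ι → ℕ} (hc : ∀ i, c i + 1 ≤ M) {u : V} (hu : u ∈ sphereInter G a c) :
    ∃ e ≤ Fintype.card ι, (G.neighborSet u).ncard =
      (G.neighborSet u ∩ sphereInter G a (fun i => c i + 1)).ncard + e := by
  classical
  have key : ∀ w ∈ G.neighborSet u \ sphereInter G a (fun i => c i + 1),
      ∃ i, ∃ s, c i = s + 1 ∧ G.edist w (a i) = s := by
    rintro w ⟨hw, hws⟩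
    simp only [sphereInter, Set.mem_ofPred_eq, not_forall] at hws
    obtain ⟨i, hi⟩ := hws
    have := hc i
    rcases hG.adj_edist (by omega) (G.adj_symm hw) (hu i) with h | ⟨s, hs, h⟩
    · exact (hi h).elim
    · exact ⟨i, s, hs, h⟩
  choose! φ s hs hφ using key
  refine ⟨(G.neighborSet u \ sphereInter G a (fun i => c i + 1)).ncard, ?_,
    (Set.ncard_inter_add_ncard_sdiff_eq_ncard _ _).symm⟩
  rw [← Nat.card_eq_fintype_card, ← Set.ncard_univ]
  refine Set.ncard_le_ncard_of_injOn φ (fun _ _ => Set.mem_univ _) ?_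
  intro w hw w' hw' heq
  have h1 := hs w hw
  have h2 := hs w' hw'
  rw [heq] at h1
  have h3 : s w = s w' := by omega
  have h4 := hu (φ w')
  rw [h2] at h4
  have := hc (φ w')
  exact hG.closer_unique (by omega) h4 hw.1 (by rw [← h3, ← heq]; exact hφ w hw) hw'.1 (hφ w' hw')

theorem ncard_adj_inter_sphereInter_of_nontrivial [Finite V] [Nonempty ι] (hG : IsLocallyTree G M)
    {a : ι → V} {c : ι → ℕ} (hc : ∀ i j, c i + c j + 2 ≤ M)
    (h : (sphereInter G a c).Nontrivial) {u : V} (hu : u ∈ sphereInter G a c) :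
    (G.neighborSet u ∩ sphereInter G a (fun i => c i + 1)).ncard + 1 = (G.neighborSet u).ncard := by
  obtain ⟨b, rfl⟩ : ∃ b : ι → ℕ, c = fun i => b i + 1 := by
    refine ⟨fun i => c i - 1, funext fun i => ?_⟩
    have : c i ≠ 0 := fun hi =>
      Set.not_subsingleton_iff.2 h (subsingleton_sphereInter hi)
    exact (Nat.sub_add_cancel (by omega)).symm
  obtain ⟨w, hw, huw⟩ := hG.exists_adj_mem_sphereInter
    (fun i j => by have : b i + 1 + (b j + 1) + 2 ≤ M := hc i j; omega) h hu
  have : G.neighborSet u ∩ sphereInter G a (fun i => b i + 1 + 1) = G.neighborSet u \ {w} := by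
    ext y
    simp only [Set.mem_inter_iff, Set.mem_sdiff, Set.mem_singleton_iff]
    refine and_congr_right fun hy => ⟨?_, fun hyw i => ?_⟩
    · rintro hy2 rfl
      obtain ⟨i⟩ := ‹Nonempty ι›
      have h1 : G.edist y (a i) = (b i + 1 + 1 : ℕ) := hy2 i
      rw [hw i] at h1
      norm_cast at h1
      omega
    · have hci : b i + 1 + (b i + 1) + 2 ≤ M := hc i i
      have hui : G.edist u (a i) = (b i + 1 : ℕ) := hu i
      rcases hG.adj_edist (by omega) (G.adj_symm hy) hui with h1 | ⟨s, hs, h1⟩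
      · exact h1
      · obtain rfl : b i = s := by omega
        exact (hyw (hG.closer_unique (by omega) hui hy h1 huw (hw i))).elim
  rw [this, Set.ncard_sdiff_singleton_add_one (show w ∈ G.neighborSet u from huw)]

theorem ncard_sphereInter_add_one [Finite V] [Fintype ι] [Nonempty ι] (hG : IsLocallyTree G M)
    {d : ℕ} (hd : ∀ y, (G.neighborSet y).ncard = d) {a : ι → V} {c : ι → ℕ}
    (hc : ∀ i j, c i + c j + 2 ≤ M) :
    (sphereInter G a (fun i => c i + 1)).ncard = 0 ∨
    (sphereInter G a (fun i => c i + 1)).ncard = 1 ∨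
    (∃ e ≤ Fintype.card ι, d = (sphereInter G a (fun i => c i + 1)).ncard + e) ∨
    ((sphereInter G a (fun i => c i + 1)).ncard : ℤ) = (d - 1) * (sphereInter G a c).ncard := by
  classical
  rcases Set.subsingleton_or_nontrivial (sphereInter G a (fun i => c i + 1)) with hs | hX
  · have := Set.ncard_le_one_iff_subsingleton.2 hs
    omega
  have hstep := fun x hx => hG.exists_adj_mem_sphereInter hc hX (x := x) hx
  rcases Set.subsingleton_or_nontrivial (sphereInter G a c) with hs | hY
  · right; right; left
    obtain ⟨x, hx⟩ := hX.nonempty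
    obtain ⟨u, hu, -⟩ := hstep x hx
    obtain ⟨e, he, heq⟩ := hG.ncard_adj_inter_sphereInter
      (fun i => by have := hc i i; omega) hu
    refine ⟨e, he, ?_⟩
    rw [← hd u, heq, Set.inter_eq_self_of_subset_right]
    intro y hy
    obtain ⟨w, hw, hyw⟩ := hstep y hy
    rw [hs hu hw]
    exact hyw.symm
  · right; right; right
    have := Fintype.ofFinite V
    let X := (sphereInter G a (fun i => c i + 1)).toFinset
    let Y := (sphereInter G a c).toFinset
    have hcount : X.card * 1 = Y.card * (d - 1) := by
      refine Finset.card_mul_eq_card_mul (r := G.Adj) ?_ ?_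
      · intro x hx
        have hx' : x ∈ sphereInter G a (fun i => c i + 1) := by simpa [X] using hx
        obtain ⟨u, hu, hxu⟩ := hstep x hx'
        rw [Finset.card_eq_one]
        refine ⟨u, Finset.eq_singleton_iff_unique_mem.2 ⟨?_, ?_⟩⟩
        · simpa [Y, Finset.mem_bipartiteAbove] using ⟨hu, hxu⟩
        · intro w hw
          obtain ⟨hw1, hw2⟩ : w ∈ sphereInter G a c ∧ G.Adj x w := by
            simpa [Y, Finset.mem_bipartiteAbove] using hw
          obtain ⟨i⟩ := ‹Nonempty ι›
          have := hc i i
          exact hG.closer_unique (by omega) (hx' i) hw2 (hw1 i) hxu (hu i)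
      · intro u hu
        have hu' : u ∈ sphereInter G a c := by simpa [Y] using hu
        have h1 := hG.ncard_adj_inter_sphereInter_of_nontrivial hc hY hu'
        rw [hd u] at h1
        have h2 : (X.bipartiteBelow G.Adj u : Set V) =
            G.neighborSet u ∩ sphereInter G a (fun i => c i + 1) := by
          ext y
          simp [X, G.adj_comm, and_comm]
        rw [← Set.ncard_coe_finset, h2]
        omega
    obtain ⟨y, hy⟩ := hY.nonempty
    have h1 := hG.ncard_adj_inter_sphereInter_of_nontrivial hc hY hy
    rw [hd y] at h1
    rw [Set.ncard_eq_toFinset_card', Set.ncard_eq_toFinset_card']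
    change (X.card : ℤ) = (d - 1) * Y.card
    have h2 : ((d - 1 : ℕ) : ℤ) = (d : ℤ) - 1 := by
      rw [Nat.cast_sub (by omega), Nat.cast_one]
    rw [← h2, mul_comm]
    exact_mod_cast (mul_one X.card).symm.trans hcount

end IsLocallyTree

end Counting

section EventuallyPolynomial

open Filter

/-- The function `f` agrees on a set of the ultrafilter `U` with an integer polynomial in the
functions `n` and `d`. -/
def IsEventuallyPoly (U : Ultrafilter ℕ) (n d : ℕ → ℕ) (f : ℕ → ℤ) : Prop :=
  ∃ p : MvPolynomial (Fin 2) ℤ,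
    ∀ᶠ k in (U : Filter ℕ), f k = MvPolynomial.eval ![(n k : ℤ), (d k : ℤ)] p

namespace IsEventuallyPoly

variable {U : Ultrafilter ℕ} {n d : ℕ → ℕ} {f f₁ f₂ : ℕ → ℤ}

theorem const (z : ℤ) : IsEventuallyPoly U n d (fun _ => z) :=
  ⟨MvPolynomial.C z, by simp⟩

theorem fst : IsEventuallyPoly U n d (fun k => n k) :=
  ⟨MvPolynomial.X 0, by simp⟩

theorem snd : IsEventuallyPoly U n d (fun k => d k) :=
  ⟨MvPolynomial.X 1, by simp⟩

theorem sub (h₁ : IsEventuallyPoly U n d f₁) (h₂ : IsEventuallyPoly U n d f₂) :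
    IsEventuallyPoly U n d (fun k => f₁ k - f₂ k) := by
  obtain ⟨p, hp⟩ := h₁
  obtain ⟨q, hq⟩ := h₂
  refine ⟨p - q, ?_⟩
  filter_upwards [hp, hq] with k h1 h2
  rw [h1, h2, map_sub]

theorem add (h₁ : IsEventuallyPoly U n d f₁) (h₂ : IsEventuallyPoly U n d f₂) :
    IsEventuallyPoly U n d (fun k => f₁ k + f₂ k) := by
  obtain ⟨p, hp⟩ := h₁
  obtain ⟨q, hq⟩ := h₂
  refine ⟨p + q, ?_⟩
  filter_upwards [hp, hq] with k h1 h2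
  rw [h1, h2, map_add]

theorem mul (h₁ : IsEventuallyPoly U n d f₁) (h₂ : IsEventuallyPoly U n d f₂) :
    IsEventuallyPoly U n d (fun k => f₁ k * f₂ k) := by
  obtain ⟨p, hp⟩ := h₁
  obtain ⟨q, hq⟩ := h₂
  refine ⟨p * q, ?_⟩
  filter_upwards [hp, hq] with k h1 h2
  rw [h1, h2, map_mul]

theorem congr (h : IsEventuallyPoly U n d f₁) (hf : ∀ᶠ k in (U : Filter ℕ), f k = f₁ k) :
    IsEventuallyPoly U n d f := by
  obtain ⟨p, hp⟩ := h
  refine ⟨p, ?_⟩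
  filter_upwards [hp, hf] with k h1 h2
  rw [h2, h1]

theorem of_eventually_or (h₁ : IsEventuallyPoly U n d f₁) (h₂ : IsEventuallyPoly U n d f₂)
    (hf : ∀ᶠ k in (U : Filter ℕ), f k = f₁ k ∨ f k = f₂ k) : IsEventuallyPoly U n d f :=
  (Ultrafilter.eventually_or.1 hf).elim h₁.congr h₂.congr

theorem sum {σ : Type*} (s : Finset σ) {F : σ → ℕ → ℤ}
    (h : ∀ i ∈ s, IsEventuallyPoly U n d (F i)) :
    IsEventuallyPoly U n d (fun k => ∑ i ∈ s, F i k) := by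
  classical
  induction s using Finset.induction_on with
  | empty => simpa using const 0
  | insert i s hi ih =>
    simp only [Finset.sum_insert hi]
    exact (h i (by simp)).add (ih fun j hj => h j (by simp [hj]))

theorem ncard_sphereInter {V : ℕ → Type} [∀ k, Fintype (V k)] {H : ∀ k, SimpleGraph (V k)}
    (hreg : ∀ k (v : V k), ((H k).neighborSet v).ncard = d k)
    (htree : ∀ M, ∀ᶠ k in (U : Filter ℕ), IsLocallyTree (H k) M)
    {ι : Type*} [Fintype ι] (i₀ : ι) (a : ∀ k, ι → V k) (c : ι → ℕ) :
    IsEventuallyPoly U n d (fun k => (sphereInter (H k) (a k) c).ncard) := by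
  induction hs : c i₀ generalizing c with
  | zero =>
    refine (const 0).of_eventually_or (const 1) (Eventually.of_forall fun k => ?_)
    have := Set.ncard_le_one_iff_subsingleton.2
      (IsLocallyTree.subsingleton_sphereInter (G := H k) (a := a k) hs)
    omega
  | succ s ih =>
    by_cases hpos : ∃ i, c i = 0
    · obtain ⟨i, hi⟩ := hpos
      refine (const 0).of_eventually_or (const 1) (Eventually.of_forall fun k => ?_)
      have := Set.ncard_le_one_iff_subsingleton.2
        (IsLocallyTree.subsingleton_sphereInter (G := H k) (a := a k) hi)
      omega
    obtain ⟨b, rfl⟩ : ∃ b : ι → ℕ, c = fun i => b i + 1 := by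
      refine ⟨fun i => c i - 1, funext fun i => ?_⟩
      have : c i ≠ 0 := fun hi => hpos ⟨i, hi⟩
      exact (Nat.sub_add_cancel (by omega)).symm
    have : Nonempty ι := ⟨i₀⟩
    obtain ⟨B, hB⟩ := (Set.finite_range b).bddAbove
    have hB' : ∀ i, b i ≤ B := fun i => hB ⟨i, rfl⟩
    have key := (htree (2 * B + 2)).mono fun k hk =>
      hk.ncard_sphereInter_add_one (hreg k) (a := a k) (c := b)
        (fun i j => by have := hB' i; have := hB' j; omega)
    rcases Ultrafilter.eventually_or.1 key with h | key
    · exact (const 0).congr (h.mono fun k hk => by exact_mod_cast hk)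
    rcases Ultrafilter.eventually_or.1 key with h | key
    · exact (const 1).congr (h.mono fun k hk => by exact_mod_cast hk)
    rcases Ultrafilter.eventually_or.1 key with h | key
    · obtain ⟨e, -, he⟩ := (Ultrafilter.eventually_exists_mem_iff
        (Set.finite_Iic (Fintype.card ι))).1 h
      exact (snd.sub (const e)).congr (he.mono fun k hk => by push_cast [hk]; ring)
    · exact ((snd.sub (const 1)).mul (ih b (Nat.succ_injective hs))).congr key

/-- Counting vertices subject to finitely many conditions, each of which prescribes or forbids one
distance to a parameter. -/
theorem ncard_positive_negative {V : ℕ → Type} [∀ k, Fintype (V k)]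
    {H : ∀ k, SimpleGraph (V k)}
    (hreg : ∀ k (v : V k), ((H k).neighborSet v).ncard = d k)
    (htree : ∀ M, ∀ᶠ k in (U : Filter ℕ), IsLocallyTree (H k) M)
    {m : ℕ} (a : ∀ k, Fin m → V k) (A B : Finset (Fin m × ℕ)) :
    IsEventuallyPoly U (fun k => Fintype.card (V k)) d (fun k =>
      ({x | (∀ q ∈ A, (H k).edist x (a k q.1) = q.2) ∧
        ∀ q ∈ B, (H k).edist x (a k q.1) ≠ q.2} : Set (V k)).ncard) := by
  classical
  induction B using Finset.induction_on generalizing A with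
  | empty =>
    rcases A.eq_empty_or_nonempty with rfl | ⟨q₀, hq₀⟩
    · simpa [Set.ncard_univ] using fst
    · refine (ncard_sphereInter hreg htree (⟨q₀, hq₀⟩ : A) (fun k q => a k q.1.1)
        (fun q => q.1.2)).congr (Eventually.of_forall fun k => ?_)
      simp [sphereInter]
  | insert b B hb ih =>
    refine ((ih A).sub (ih (insert b A))).congr (Eventually.of_forall fun k => ?_)
    have h := Set.ncard_inter_add_ncard_sdiff_eq_ncard
      {x : V k | (∀ q ∈ A, (H k).edist x (a k q.1) = q.2) ∧
        ∀ q ∈ B, (H k).edist x (a k q.1) ≠ q.2} {x | (H k).edist x (a k b.1) = b.2}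
    rw [eq_sub_iff_add_eq, ← Nat.cast_add, ← h, add_comm]
    congr 3
    · ext x
      simp only [Finset.forall_mem_insert, Set.mem_ofPred_eq, Set.mem_inter_iff]
      tauto
    · ext x
      simp only [Finset.forall_mem_insert, Set.mem_ofPred_eq, Set.mem_sdiff]
      tauto

end IsEventuallyPoly

end EventuallyPolynomial

/-- Let `d, g : ℕ → ℕ` be non-decreasing unbounded functions, let
`(H k)` be a sequence of finite simple graphs such that `H k` is `d k`-regular with
girth at least `g k`, and let `U` be a nonprincipal ultrafilter on `ℕ`.  Then for every
graph formula `φ(x, y₁, …, yₘ)` with one object variable and every choice of parameter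
tuples `ā_k ∈ (H k)^m`, there is a polynomial `p ∈ ℤ[t₁, t₂]` such that the set of `k`
for which the number of `x` satisfying `φ(x, ā_k)` in `H k` equals `p(|H k|, d k)`
belongs to `U`. -/
theorem ultraproduct_definable_card_polynomial (d g : ℕ → ℕ)
    (hdmono : Monotone d) (hdunb : ∀ N, ∃ k, N < d k)
    (hgmono : Monotone g) (hgunb : ∀ N, ∃ k, N < g k)
    (V : ℕ → Type) [∀ k, Fintype (V k)] (H : ∀ k, SimpleGraph (V k))
    (hreg : ∀ k (v : V k), ((H k).neighborSet v).ncard = d k)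
    (hgirth : ∀ k, (g k : ℕ∞) ≤ (H k).egirth)
    (U : Ultrafilter ℕ) (hU : (U : Filter ℕ) ≤ Filter.cofinite)
    (m : ℕ) (φ : Language.graph.BoundedFormula (Fin m) 1)
    (a : ∀ k, Fin m → V k) :
    haveI : ∀ k, Language.graph.Structure (V k) := fun k => (H k).structure
    ∃ p : MvPolynomial (Fin 2) ℤ,
      {k : ℕ | (Set.ncard {x : V k | φ.Realize (a k) (fun _ => x)} : ℤ) =
        MvPolynomial.eval ![(Fintype.card (V k) : ℤ), (d k : ℤ)] p} ∈ U := by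
  classical
  have hlarge : ∀ {f : ℕ → ℕ}, Monotone f → (∀ N, ∃ k, N < f k) →
      ∀ N, ∀ᶠ k in (U : Filter ℕ), N ≤ f k := fun hf hN N =>
    hU (Nat.cofinite_eq_atTop ▸ (Filter.tendsto_atTop_atTop_of_monotone hf
      fun b => (hN b).imp fun _ h => h.le).eventually_ge_atTop N)
  have htree : ∀ M, ∀ᶠ k in (U : Filter ℕ), IsLocallyTree (H k) M := fun M =>
    (hlarge hgmono hgunb (2 * M + 2)).mono fun k hk =>
      isLocallyTree_of_le_egirth (le_trans (by exact_mod_cast hk) (hgirth k))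
  obtain ⟨R, D, M, hφ⟩ := exists_realize_iff_of_sameShape φ
  let : ∀ k, Language.graph.Structure (V k) := fun k => (H k).structure
  let Q : Finset (Fin m × ℕ) := Finset.univ ×ˢ Finset.range (R + 1)
  let pos : ∀ k, V k → Finset (Fin m × ℕ) := fun k x =>
    Q.filter fun q => (H k).edist x (a k q.1) = q.2
  have hpos : ∀ k x, ∀ P ⊆ Q, pos k x = P ↔ (∀ q ∈ P, (H k).edist x (a k q.1) = q.2) ∧
      ∀ q ∈ Q \ P, (H k).edist x (a k q.1) ≠ q.2 := by
    intro k x P hP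
    constructor
    · rintro rfl
      refine ⟨fun q hq => (Finset.mem_filter.1 hq).2, fun q hq h => ?_⟩
      rw [Finset.mem_sdiff] at hq
      exact hq.2 (Finset.mem_filter.2 ⟨hq.1, h⟩)
    · rintro ⟨h1, h2⟩
      ext q
      refine ⟨fun hq => ?_, fun hq => Finset.mem_filter.2 ⟨hP hq, h1 q hq⟩⟩
      by_contra hqP
      have := Finset.mem_filter.1 hq
      exact h2 q (Finset.mem_sdiff.2 ⟨this.1, hqP⟩) this.2
  have hpoly : IsEventuallyPoly U (fun k => Fintype.card (V k)) d (fun k => ∑ P ∈ Q.powerset,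
      (if ∃ x, pos k x = P ∧ φ.Realize (a k) (fun _ => x) then 1 else 0) *
        (({x | pos k x = P} : Set (V k)).ncard : ℤ)) := by
    refine IsEventuallyPoly.sum _ fun P hP => IsEventuallyPoly.mul ?_ ?_
    · refine (IsEventuallyPoly.const 1).of_eventually_or (IsEventuallyPoly.const 0)
        (Filter.Eventually.of_forall fun k => ?_)
      split_ifs <;> simp
    · simp only [hpos _ _ P (Finset.mem_powerset.1 hP)]
      exact IsEventuallyPoly.ncard_positive_negative hreg htree a P (Q \ P)
  refine hpoly.congr ?_
  filter_upwards [htree M, hlarge hdmono hdunb (D + 1)] with k hk hdk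
  have hinv : ∀ x y, pos k x = pos k y →
      φ.Realize (a k) (fun _ => x) → φ.Realize (a k) (fun _ => y) := by
    intro x y hxy
    have hsame : SamePosition (H k) R (a k) (a k) x y := by
      intro i c hc
      have := Finset.ext_iff.1 hxy (i, c)
      simpa [pos, Q, Nat.lt_succ_of_le hc] using this
    refine (hφ (V k) (H k) hk (fun v => by rw [hreg]; omega) _ _ _ _ ?_).1
    rintro (i | i) (j | j) c hc
    · exact Iff.rfl
    · simpa [(H k).edist_comm] using hsame i c hc
    · exact hsame j c hc
    · simp
  rw [Set.ncard_eq_toFinset_card', Finset.card_eq_sum_card_fiberwise (f := pos k)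
    (t := Q.powerset) (fun x _ => by
      rw [Finset.mem_coe, Finset.mem_powerset]; exact Finset.filter_subset _ _)]
  push_cast
  refine Finset.sum_congr rfl fun P _ => ?_
  split_ifs with h
  · obtain ⟨x, rfl, hx⟩ := h
    rw [one_mul, Set.ncard_eq_toFinset_card']
    congr 2
    ext y
    simpa using fun hy => hinv x y hy.symm hx
  · rw [zero_mul, Nat.cast_eq_zero, Finset.card_eq_zero, Finset.filter_eq_empty_iff]
    exact fun x hx hxP => h ⟨x, hxP, by simpa using hx⟩

end InfiniteBranchingTree
end

section
/- Let G be an acyclic simple graph and let A be a set of vertices of G that is convex-closed, i.e. conv(A) = A. Then for every vertex b at finite distance from A (i.e. b is connected to some element of A), there exists a unique c ∈ A such that dist(b,c) = dist(b,A), where dist(b,A) is the minimum of dist(b,a) over elements a ∈ A connected to b. -/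
namespace InfiniteBranchingTree

/-- The convex closure of a set `A` of vertices of a graph `G`: `A` together with all
vertices lying on a path between two elements of `A` (in an acyclic graph, paths
between vertices in the same connected component are unique). -/
def convClosure {V : Type*} (G : SimpleGraph V) (A : Set V) : Set V :=
  A ∪ {v | ∃ a ∈ A, ∃ a' ∈ A, ∃ p : G.Walk a a', p.IsPath ∧ v ∈ p.support}

/-- The distance from a vertex `b` to a set `S` of vertices: the minimum of the
distances from `b` to the elements of `S` connected to `b`. -/
noncomputable def distToSet {V : Type*} (G : SimpleGraph V) (b : V) (S : Set V) : ℕ :=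
  sInf {n | ∃ s ∈ S, G.Reachable b s ∧ G.dist b s = n}

open SimpleGraph

theorem isPath_append {V : Type*} {G : SimpleGraph V} {u v w : V} {p : G.Walk u v}
    {q : G.Walk v w} (hp : p.IsPath) (hq : q.IsPath)
    (h : ∀ x ∈ p.support, x ∈ q.support → x = v) : (p.append q).IsPath := by
  have hq' := hq.support_nodup
  rw [← q.cons_tail_support, List.nodup_cons] at hq'
  rw [Walk.isPath_def, Walk.support_append, List.nodup_append']
  refine ⟨hp.support_nodup, hq'.2, fun x hx hxq => hq'.1 ?_⟩
  exact h x hx (List.mem_of_mem_tail hxq) ▸ hxq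

theorem distToSet_le {V : Type*} {G : SimpleGraph V} {b s : V} {S : Set V} (hs : s ∈ S)
    (h : G.Reachable b s) : distToSet G b S ≤ G.dist b s :=
  Nat.sInf_le ⟨s, hs, h, rfl⟩

theorem exists_dist_eq_distToSet {V : Type*} {G : SimpleGraph V} {b : V} {S : Set V}
    (h : ∃ s ∈ S, G.Reachable b s) :
    ∃ s ∈ S, G.Reachable b s ∧ G.dist b s = distToSet G b S := by
  obtain ⟨s, hs, hr⟩ := h
  exact Nat.sInf_mem (s := {n | ∃ s ∈ S, G.Reachable b s ∧ G.dist b s = n}) ⟨_, s, hs, hr, rfl⟩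

/-- A walk realizing the distance to a set meets the set only at its endpoint. -/
theorem eq_of_mem_support_of_length_eq_distToSet {V : Type*} {G : SimpleGraph V} {b c x : V}
    {S : Set V} {p : G.Walk b c} (hp : p.length = distToSet G b S) (hx : x ∈ p.support)
    (hxS : x ∈ S) : x = c := by
  obtain ⟨q, r, rfl⟩ := p.mem_support_iff_exists_append.mp hx
  have hle := (distToSet_le hxS q.reachable).trans (dist_le q)
  rw [Walk.length_append] at hp
  exact Walk.eq_of_length_eq_zero (p := r) (by lia)

/-- Let `G` be an acyclic simple graph and `A` a convex-closed set of
vertices.  Then every vertex `b` at finite distance from `A` has a unique nearest point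
`c ∈ A`: a unique `c ∈ A` with `dist(b, c) = dist(b, A)`. -/
theorem unique_nearest_point_of_convex {V : Type*} (G : SimpleGraph V)
    (hG : G.IsAcyclic) (A : Set V) (hA : convClosure G A = A) (b : V)
    (hb : ∃ a ∈ A, G.Reachable b a) :
    ∃! c, c ∈ A ∧ G.Reachable b c ∧ G.dist b c = distToSet G b A := by
  obtain ⟨c, hc, hbc, hdc⟩ := exists_dist_eq_distToSet hb
  refine ⟨c, ⟨hc, hbc, hdc⟩, ?_⟩
  rintro c' ⟨hc', hbc', hdc'⟩
  obtain ⟨p, hp, hpl⟩ := hbc.exists_path_of_dist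
  obtain ⟨p', hp', hpl'⟩ := hbc'.exists_path_of_dist
  obtain ⟨r, hr, -⟩ := (hbc.symm.trans hbc').exists_path_of_dist
  have hrA : ∀ x ∈ r.support, x ∈ A := fun x hx =>
    hA ▸ Or.inr ⟨c, hc, c', hc', r, hr, hx⟩
  have hpr : (p.append r).IsPath := isPath_append hp hr fun x hx hxr =>
    eq_of_mem_support_of_length_eq_distToSet (hpl.trans hdc) hx (hrA x hxr)
  have heq : p.append r = p' :=
    congrArg Subtype.val ((hG.subsingleton_path b c').elim ⟨p.append r, hpr⟩ ⟨p', hp'⟩)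
  have hlen := congrArg Walk.length heq
  rw [Walk.length_append] at hlen
  exact (Walk.eq_of_length_eq_zero (p := r) (by lia)).symm

end InfiniteBranchingTree
end
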